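/- arXiv:1808.02675 — 7 statements merged into one kernel-verified Lean document; each statement's English description precedes it below -/
import Mathlib

section
/- For every integer n ≥ 3, the packing chromatic number of the corona graph C_n ⊙ K_1 equals 4 if n ∈ {3,4}, and equals 5 if n ≥ 5. -/
/-- A packing `k`-colouring of a simple graph `G`: every vertex gets a colour in
`{1, …, k}` and any two distinct vertices sharing a colour `i` are at distance
greater than `i` in `G` (i.e. every walk joining them has length greater than `i`). -/
def IsPackingColoring {V : Type*} (G : SimpleGraph V) (k : ℕ) (π : V → ℕ) : Prop :=
  (∀ v, 1 ≤ π v ∧ π v ≤ k) ∧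
    ∀ u v : V, u ≠ v → π u = π v → ∀ p : G.Walk u v, π u < p.length

/-- The packing chromatic number of `G`: the least `k` admitting a packing `k`-colouring. -/
noncomputable def packingChromaticNumber {V : Type*} (G : SimpleGraph V) : ℕ :=
  sInf {k | ∃ π : V → ℕ, IsPackingColoring G k π}

/-- The corona `Cₙ ⊙ K₁` of the cycle on `n` vertices: the cycle vertices are
`Sum.inl i` (`i : ZMod n`, with `i` adjacent to `i ± 1`), and each cycle vertex
`Sum.inl i` additionally gets a private pendant neighbour `Sum.inr i`. -/
def coronaCycle (n : ℕ) : SimpleGraph (ZMod n ⊕ ZMod n) :=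
  SimpleGraph.fromRel (fun x y =>
    (∃ i : ZMod n, x = Sum.inl i ∧ y = Sum.inl (i + 1)) ∨
    (∃ i : ZMod n, x = Sum.inl i ∧ y = Sum.inr i))

/-- Two columns of a corona, each given by the colours of its cycle vertex and of its pendant
vertex, do not conflict when placed at distance `t` along the cycle. -/
abbrev ColumnsCompatible (t : ℕ) (x y : ℕ × ℕ) : Prop :=
  (x.1 = y.1 → x.1 < t) ∧ (x.1 = y.2 → x.1 < t + 1) ∧
    (x.2 = y.1 → x.2 < t + 1) ∧ (x.2 = y.2 → x.2 < t + 2)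

/-- The columns `f 0, …, f (n - 1)`, read cyclically, describe a packing `k`-colouring of
`coronaCycle n`. -/
abbrev IsCyclicPattern (k n : ℕ) (f : ℕ → ℕ × ℕ) : Prop :=
  ∀ i < n, ((1 ≤ (f i).1 ∧ (f i).1 ≤ k) ∧ (1 ≤ (f i).2 ∧ (f i).2 ≤ k) ∧ (f i).1 ≠ (f i).2) ∧
    ∀ t < k + 1, ¬ n ∣ t → ColumnsCompatible t (f i) (f ((i + t) % n))

set_option synthInstance.maxSize 1000 in
instance (k n : ℕ) (f : ℕ → ℕ × ℕ) : Decidable (IsCyclicPattern k n f) :=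
  inferInstance

namespace coronaCycle

variable {n : ℕ}

/-- The index of the column of a vertex. -/
def column : ZMod n ⊕ ZMod n → ZMod n := Sum.elim id id

/-- The distance of a vertex from the cycle. -/
def height : ZMod n ⊕ ZMod n → ℕ := Sum.elim (fun _ => 0) (fun _ => 1)

theorem exists_natAbs_add_height_le {u v : ZMod n ⊕ ZMod n} (p : (coronaCycle n).Walk u v) :
    u = v ∨ ∃ t : ℤ, column v = column u + (t : ZMod n) ∧
      t.natAbs + height u + height v ≤ p.length := by
  induction p with
  | nil => exact Or.inl rfl
  | @cons u w v h p ih =>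
    right
    have key : ∃ s : ℤ, column w = column u + (s : ZMod n) ∧
        s.natAbs + height u + height w ≤ 1 ∧ s.natAbs + height u ≤ 1 + height w := by
      rw [coronaCycle, SimpleGraph.fromRel_adj] at h
      obtain ⟨-, (⟨i, rfl, rfl⟩ | ⟨i, rfl, rfl⟩) | (⟨i, rfl, rfl⟩ | ⟨i, rfl, rfl⟩)⟩ := h
      · exact ⟨1, by simp [column], by simp [height], by simp [height]⟩
      · exact ⟨0, by simp [column], by simp [height], by simp [height]⟩
      · exact ⟨-1, by simp [column], by simp [height], by simp [height]⟩
      · exact ⟨0, by simp [column], by simp [height], by simp [height]⟩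
    obtain ⟨s, hs, hs₁, hs₂⟩ := key
    rw [SimpleGraph.Walk.length_cons]
    rcases ih with rfl | ⟨t, ht, hle⟩
    · exact ⟨s, hs, by omega⟩
    · exact ⟨s + t, by rw [ht, hs]; push_cast; ring, by omega⟩

theorem adj_add_one [Fact (1 < n)] (i : ZMod n) :
    (coronaCycle n).Adj (Sum.inl i) (Sum.inl (i + 1)) := by
  rw [coronaCycle, SimpleGraph.fromRel_adj]
  exact ⟨by simp, Or.inl (Or.inl ⟨i, rfl, rfl⟩)⟩

theorem adj_pendant (i : ZMod n) : (coronaCycle n).Adj (Sum.inl i) (Sum.inr i) := by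
  rw [coronaCycle, SimpleGraph.fromRel_adj]
  exact ⟨by simp, Or.inl (Or.inr ⟨i, rfl, rfl⟩)⟩

theorem exists_walk_length_eq [Fact (1 < n)] (i : ZMod n) (t : ℕ) :
    ∃ p : (coronaCycle n).Walk (Sum.inl i) (Sum.inl (i + t)), p.length = t := by
  induction t with
  | zero => exact ⟨SimpleGraph.Walk.nil.copy rfl (by simp), by simp⟩
  | succ t ih =>
    obtain ⟨p, hp⟩ := ih
    exact ⟨(p.concat (adj_add_one _)).copy rfl (by push_cast; rw [add_assoc]), by simp [hp]⟩

end coronaCycle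

open coronaCycle in
theorem IsCyclicPattern.isPackingColoring {k n : ℕ} [NeZero n] {f : ℕ → ℕ × ℕ}
    (hf : IsCyclicPattern k n f) :
    IsPackingColoring (coronaCycle n) k
      (Sum.elim (fun z => (f z.val).1) (fun z => (f z.val).2)) := by
  set π : ZMod n ⊕ ZMod n → ℕ := Sum.elim (fun z => (f z.val).1) (fun z => (f z.val).2) with hπ
  have bounds : ∀ v, 1 ≤ π v ∧ π v ≤ k := by
    rintro (z | z)
    · exact (hf z.val z.val_lt).1.1
    · exact (hf z.val z.val_lt).1.2.1
  have far : ∀ (u v : ZMod n ⊕ ZMod n) (t : ℕ), u ≠ v → π u = π v →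
      column v = column u + (t : ZMod n) → π u < t + height u + height v := by
    intro u v t huv hc hcol
    by_contra! hle
    have htk : t < k + 1 := by have := (bounds u).2; omega
    by_cases hdvd : n ∣ t
    · rw [(ZMod.natCast_eq_zero_iff t n).2 hdvd, add_zero] at hcol
      rcases u with i | i <;> rcases v with j | j <;>
        simp only [column, Sum.elim_inl, Sum.elim_inr, id] at hcol <;> subst hcol
      · exact huv rfl
      · exact (hf _ (ZMod.val_lt _)).1.2.2 hc
      · exact (hf _ (ZMod.val_lt _)).1.2.2 hc.symm
      · exact huv rfl
    · have hval : (column v).val = ((column u).val + t) % n := by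
        rw [hcol, ZMod.val_add, ZMod.val_natCast, Nat.add_mod_mod]
      have := (hf _ (ZMod.val_lt (column u))).2 t htk hdvd
      rw [← hval] at this
      rcases u with i | i <;> rcases v with j | j <;>
        simp only [column, height, hπ, Sum.elim_inl, Sum.elim_inr, id] at this hc hle <;> omega
  refine ⟨bounds, fun u v huv hc p => ?_⟩
  obtain h | ⟨t, ht, hle⟩ := exists_natAbs_add_height_le p
  · exact absurd h huv
  · obtain ⟨m, rfl | rfl⟩ := t.eq_nat_or_neg
    · have := far u v m huv hc (by simpa using ht)
      simp only [Int.natAbs_natCast] at hle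
      omega
    · have := far v u m huv.symm hc.symm (by rw [ht]; simp)
      simp only [Int.natAbs_neg, Int.natAbs_natCast] at hle
      omega

/-- The block of columns used to lengthen cyclic patterns. -/
abbrev repeatingBlock : List (ℕ × ℕ) := [(1, 2), (3, 1), (1, 2), (4, 1), (1, 2), (5, 1)]

theorem IsCyclicPattern.add_six {n : ℕ} (hn : 6 ≤ n) {f : ℕ → ℕ × ℕ}
    (hf : IsCyclicPattern 5 n f) (hpre : ∀ i < 4, f i = repeatingBlock.getD i 0)
    (hfour : (f 4).1 = 1) :
    IsCyclicPattern 5 (n + 6)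
      (fun i => if i < 6 then repeatingBlock.getD i 0 else f (i - 6)) := by
  have hblock : IsCyclicPattern 5 6 (fun i => repeatingBlock.getD i 0) := by decide
  have hpos : ∀ t, 0 < t → t < 6 → ¬ n ∣ t := fun t h₀ h₁ h => by
    have := Nat.le_of_dvd h₀ h
    omega
  intro i hi
  dsimp only
  refine ⟨?_, fun t ht hdvd => ?_⟩
  · split_ifs with h
    · exact (hblock i h).1
    · exact (hf (i - 6) (by omega)).1
  have ht₀ : 0 < t := Nat.pos_of_ne_zero fun h => hdvd (h ▸ dvd_zero _)
  by_cases h : i < 6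
  · rw [if_pos h, Nat.mod_eq_of_lt (by omega)]
    by_cases h' : i + t < 6
    · have := (hblock i h).2 t ht (Nat.not_dvd_of_pos_of_lt ht₀ ht)
      rw [if_pos h']
      rwa [Nat.mod_eq_of_lt h'] at this
    · rw [if_neg h']
      by_cases h₄ : i + t - 6 < 4
      · have := (hblock i h).2 t ht (Nat.not_dvd_of_pos_of_lt ht₀ ht)
        rw [hpre _ h₄]
        rwa [Nat.mod_eq_sub_mod (by omega), Nat.mod_eq_of_lt (by omega)] at this
      · obtain rfl : i = 5 := by omega
        obtain rfl : t = 5 := by omega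
        have := (hf 4 (by omega)).1
        simp only [ColumnsCompatible, List.getD_cons_succ, List.getD_cons_zero, Nat.reduceAdd,
          Nat.reduceSub]
        omega
  · rw [if_neg h]
    have key := (hf (i - 6) (by omega)).2 t ht (hpos t ht₀ ht)
    by_cases h' : i + t < n + 6
    · rw [Nat.mod_eq_of_lt h', if_neg (by omega)]
      rwa [Nat.mod_eq_of_lt (by omega), show i - 6 + t = i + t - 6 by omega] at key
    · rw [Nat.mod_eq_sub_mod (by omega), Nat.mod_eq_of_lt (by omega), if_pos (by omega)]
      rw [Nat.mod_eq_sub_mod (by omega), Nat.mod_eq_of_lt (by omega),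
        show i - 6 + t - n = i + t - (n + 6) by omega] at key
      by_cases h₄ : i + t - (n + 6) < 4
      · rwa [hpre _ h₄] at key
      · obtain rfl : t = 5 := by omega
        rw [show i + 5 - (n + 6) = 4 by omega]
        simp only [ColumnsCompatible, List.getD_cons_succ, List.getD_cons_zero]
        omega

theorem exists_isCyclicPattern_five_of_six_le (n : ℕ) (hn : 6 ≤ n) :
    ∃ f, IsCyclicPattern 5 n f ∧ (∀ i < 4, f i = repeatingBlock.getD i 0) ∧ (f 4).1 = 1 := by
  induction n using Nat.strong_induction_on with
  | _ n ih =>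
    by_cases h : n < 12
    · interval_cases n
      · exact ⟨fun i => repeatingBlock.getD i 0, by decide⟩
      · exact ⟨fun i => [(1, 2), (3, 1), (1, 2), (4, 1), (1, 3), (2, 1), (5, 1)].getD i 0,
          by decide⟩
      · exact ⟨fun i => [(1, 2), (3, 1), (1, 2), (4, 1), (1, 2), (3, 1), (1, 2), (5, 1)].getD i 0,
          by decide⟩
      · exact ⟨fun i => [(1, 2), (3, 1), (1, 2), (4, 1), (1, 2), (3, 1), (2, 1), (1, 4), (5, 1)].getD i 0,
          by decide⟩
      · exact ⟨fun i => [(1, 2), (3, 1), (1, 2), (4, 1), (1, 5), (2, 1), (3, 1), (1, 2),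
            (4, 1), (5, 1)].getD i 0,
          by decide⟩
      · exact ⟨fun i => [(1, 2), (3, 1), (1, 2), (4, 1), (1, 5), (2, 1), (3, 1), (1, 2),
            (4, 1), (1, 2), (5, 1)].getD i 0,
          by decide⟩
    · obtain ⟨f, hf, hpre, hfour⟩ := ih (n - 6) (by omega) (by omega)
      refine ⟨_, Nat.sub_add_cancel hn ▸ hf.add_six (by omega) hpre hfour, ?_, ?_⟩
      · intro i hi
        rw [if_pos (by omega)]
      · simp

/-- Exhaustive search: no sequence of at most `s` columns with colours in `{1, …, k}` can be put
in front of the columns `h` so that columns at distance at most `m` are compatible. -/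
def noExtension (k m : ℕ) : ℕ → List (ℕ × ℕ) → Bool
  | 0, _ => false
  | s + 1, h => (List.range' 1 k).all fun a => (List.range' 1 k).all fun b =>
      a == b || !((List.range m).all fun j => h[j]?.all fun y => ColumnsCompatible (j + 1) (a, b) y)
        || noExtension k m s ((a, b) :: h)

theorem noExtension_eq_false {k m n : ℕ} {F : ZMod n → ℕ × ℕ}
    (hF : ∀ i, ((1 ≤ (F i).1 ∧ (F i).1 ≤ k) ∧ (1 ≤ (F i).2 ∧ (F i).2 ≤ k) ∧ (F i).1 ≠ (F i).2) ∧
      ∀ t, 1 ≤ t → t ≤ m → ColumnsCompatible t (F i) (F (i + t)))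
    (s : ℕ) (h : List (ℕ × ℕ)) (i : ZMod n)
    (hh : ∀ (j : ℕ) y, h[j]? = some y → y = F (i + j)) : noExtension k m s h = false := by
  induction s generalizing h i with
  | zero => rfl
  | succ s ih =>
    have hstep : noExtension k m s (F (i - 1) :: h) = false := by
      refine ih _ (i - 1) fun j y hy => ?_
      cases j with
      | zero => simpa using hy.symm
      | succ j =>
        rw [hh j y (by simpa using hy)]
        push_cast
        congr 1
        ring
    obtain ⟨⟨⟨h₁, h₂⟩, ⟨h₃, h₄⟩, hne⟩, hcompat⟩ := hF (i - 1)
    rw [noExtension, List.all_eq_false]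
    refine ⟨(F (i - 1)).1, by rw [List.mem_range'_1]; omega, ?_⟩
    rw [Bool.not_eq_true, List.all_eq_false]
    refine ⟨(F (i - 1)).2, by rw [List.mem_range'_1]; omega, ?_⟩
    have hall : ((List.range m).all fun j => h[j]?.all fun y =>
        ColumnsCompatible (j + 1) ((F (i - 1)).1, (F (i - 1)).2) y) = true := by
      rw [List.all_eq_true]
      intro j hj
      cases hy : h[j]? with
      | none => rfl
      | some y =>
        have := hcompat (j + 1) (by omega) (by simpa using hj)
        rw [show i - 1 + ((j + 1 : ℕ) : ZMod n) = i + j by push_cast; ring, ← hh j y hy] at this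
        rw [Option.all_some]
        exact decide_eq_true this
    rw [hall, hstep, beq_eq_false_iff_ne.2 hne]
    decide

open coronaCycle in
theorem not_isPackingColoring_of_noExtension {k m n s : ℕ} (hn : 1 < n) (hm : m < n)
    (hs : noExtension k m s [] = true) (π : ZMod n ⊕ ZMod n → ℕ) :
    ¬ IsPackingColoring (coronaCycle n) k π := by
  rintro ⟨hb, hd⟩
  have : Fact (1 < n) := ⟨hn⟩
  refine absurd (noExtension_eq_false (F := fun i => (π (Sum.inl i), π (Sum.inr i))) (k := k)
    (m := m) (fun i => ⟨⟨hb _, hb _, fun h => ?_⟩, fun t ht htm => ?_⟩) s [] 0 (by simp))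
    (by simp [hs])
  · have := hd _ _ (by simp) h (adj_pendant i).toWalk
    have := hb (Sum.inl i)
    simp at *
    omega
  · have hne : i ≠ i + (t : ZMod n) := by
      intro h
      have := (ZMod.natCast_eq_zero_iff t n).1 (left_eq_add.1 h)
      exact absurd (Nat.le_of_dvd ht this) (by omega)
    obtain ⟨p, hp⟩ := exists_walk_length_eq i t
    refine ⟨fun h => ?_, fun h => ?_, fun h => ?_, fun h => ?_⟩
    · simpa [hp] using hd _ _ (by simpa using hne) h p
    · simpa [hp] using hd _ _ (by simp) h (p.concat (adj_pendant _))
    · simpa [hp] using hd _ _ (by simp) h (p.cons (adj_pendant i).symm)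
    · simpa [hp, Nat.lt_succ_iff] using hd _ _ (by simpa using hne) h
        ((p.concat (adj_pendant _)).cons (adj_pendant i).symm)

theorem packingChromaticNumber_eq_succ {V : Type*} {G : SimpleGraph V} {k : ℕ} {π : V → ℕ}
    (hπ : IsPackingColoring G (k + 1) π) (hk : ∀ π, ¬ IsPackingColoring G k π) :
    packingChromaticNumber G = k + 1 := by
  refine IsLeast.csInf_eq ⟨⟨π, hπ⟩, ?_⟩
  rintro l ⟨ρ, hρ⟩
  by_contra! hl
  exact hk ρ ⟨fun v => ⟨(hρ.1 v).1, (hρ.1 v).2.trans (by omega)⟩, hρ.2⟩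

theorem packingChromaticNumber_coronaCycle (n : ℕ) (hn : 3 ≤ n) :
    packingChromaticNumber (coronaCycle n) = if n ≤ 4 then 4 else 5 := by
  have : NeZero n := ⟨by omega⟩
  split_ifs with h
  · have hpat : IsCyclicPattern 4 n
        (fun i => if n = 3 then [(1, 2), (3, 1), (4, 1)].getD i 0
          else repeatingBlock.getD i 0) := by
      interval_cases n <;> decide
    exact packingChromaticNumber_eq_succ hpat.isPackingColoring
      (not_isPackingColoring_of_noExtension (m := 2) (s := 4) (by omega) (by omega)
        (by decide +kernel))
  · have hpat : ∃ f, IsCyclicPattern 5 n f := by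
      rcases Nat.lt_or_ge n 6 with h₆ | h₆
      · obtain rfl : n = 5 := by omega
        exact ⟨fun i => [(1, 2), (3, 1), (1, 2), (4, 1), (5, 1)].getD i 0, by decide⟩
      · obtain ⟨f, hf, -⟩ := exists_isCyclicPattern_five_of_six_le n h₆
        exact ⟨f, hf⟩
    obtain ⟨f, hf⟩ := hpat
    exact packingChromaticNumber_eq_succ hf.isPackingColoring
      (not_isPackingColoring_of_noExtension (m := 4) (s := 10) (by omega) (by omega)
        (by decide +kernel))
end

section
/- Let X be the graph with vertex set {u_0,…,u_8} ∪ {v_0,…,v_8}, edges u_iu_{i+1} and v_iv_{i+1} for 0 ≤ i ≤ 7, and edges u_iv_i for 2 ≤ i ≤ 6, and let π be a packing 5-colouring of X. If for some integer i with 3 ≤ i ≤ 5 we have π(u_i) ≠ 1 and π(v_i) ≠ 1, then one of u_i, v_i has colour 2, and the three neighbours of that vertex have colours 3, 4 and 5 (in some order). -/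
/-- The graph `X` on vertices `u_0, …, u_8` (`Sum.inl`) and `v_0, …, v_8` (`Sum.inr`),
with the path edges `u_i u_{i+1}`, `v_i v_{i+1}` for `0 ≤ i ≤ 7` and the vertical
edges `u_i v_i` for `2 ≤ i ≤ 6`. -/
def graphX : SimpleGraph (Fin 9 ⊕ Fin 9) :=
  SimpleGraph.fromRel (fun x y =>
    (∃ i : Fin 9, (i : ℕ) ≤ 7 ∧
      ((x = Sum.inl i ∧ y = Sum.inl (i + 1)) ∨ (x = Sum.inr i ∧ y = Sum.inr (i + 1)))) ∨
    (∃ i : Fin 9, 2 ≤ (i : ℕ) ∧ (i : ℕ) ≤ 6 ∧ x = Sum.inl i ∧ y = Sum.inr i))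

instance Sum.instLawfulBEq {α β : Type*} [BEq α] [BEq β] [LawfulBEq α] [LawfulBEq β] :
    LawfulBEq (α ⊕ β) where
  rfl {x} := by
    cases x
    · exact beq_self_eq_true (α := α) _
    · exact beq_self_eq_true (α := β) _
  eq_of_beq {x y} h := by
    cases x <;> cases y
    · exact congrArg Sum.inl (eq_of_beq (α := α) h)
    · cases h
    · cases h
    · exact congrArg Sum.inr (eq_of_beq (α := β) h)

/-- Backtracking search over the extensions of the partial colouring `a` to the vertices in a list,
with colours in `{1, …, k}`, where two vertices `x ≠ y` may not share a colour `c ≥ d x y`.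
It returns `true` if every branch reaches a partial colouring accepted by `P`. -/
def packingSearch {V : Type*} [DecidableEq V] (d : V → V → ℕ) (k : ℕ)
    (P : List (V × ℕ) → Bool) : List V → List (V × ℕ) → Bool
  | [], a => P a
  | x :: l, a => P a || (List.range' 1 k).all fun c =>
      (a.any fun e => e.2 == c && decide (x ≠ e.1) && decide (d x e.1 ≤ c)) ||
        packingSearch d k P l ((x, c) :: a)

theorem IsPackingColoring.exists_of_packingSearch {V : Type*} [DecidableEq V] {G : SimpleGraph V}
    {k : ℕ} {π : V → ℕ} (hπ : IsPackingColoring G k π) {d : V → V → ℕ}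
    (hd : ∀ x y, ∃ p : G.Walk x y, p.length ≤ d x y) {P : List (V × ℕ) → Bool} :
    ∀ {l : List V} {a : List (V × ℕ)}, packingSearch d k P l a → (∀ e ∈ a, π e.1 = e.2) →
      ∃ b, P b ∧ ∀ e ∈ b, π e.1 = e.2
  | [], a, h, ha => ⟨a, h, ha⟩
  | x :: l, a, h, ha => by
    rw [packingSearch, Bool.or_eq_true, List.all_eq_true] at h
    rcases h with h | h
    · exact ⟨a, h, ha⟩
    have hx := hπ.1 x
    have hc := h (π x) (by rw [List.mem_range'_1]; omega)
    rw [Bool.or_eq_true, List.any_eq_true] at hc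
    rcases hc with ⟨e, he, hec⟩ | hc
    · simp only [Bool.and_eq_true, beq_iff_eq, decide_eq_true_eq] at hec
      obtain ⟨⟨hex, hne⟩, hle⟩ := hec
      obtain ⟨p, hp⟩ := hd x e.1
      have := hπ.2 x e.1 hne (by rw [ha e he, hex]) p
      omega
    · refine hπ.exists_of_packingSearch hd hc fun e he => ?_
      rcases List.mem_cons.1 he with rfl | he
      · rfl
      · exact ha e he

namespace graphX

theorem adj_iff (x y : Fin 9 ⊕ Fin 9) : graphX.Adj x y ↔ x ≠ y ∧
    (((∃ i : Fin 9, (i : ℕ) ≤ 7 ∧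
      ((x = Sum.inl i ∧ y = Sum.inl (i + 1)) ∨ (x = Sum.inr i ∧ y = Sum.inr (i + 1)))) ∨
    (∃ i : Fin 9, 2 ≤ (i : ℕ) ∧ (i : ℕ) ≤ 6 ∧ x = Sum.inl i ∧ y = Sum.inr i)) ∨
    ((∃ i : Fin 9, (i : ℕ) ≤ 7 ∧
      ((y = Sum.inl i ∧ x = Sum.inl (i + 1)) ∨ (y = Sum.inr i ∧ x = Sum.inr (i + 1)))) ∨
    (∃ i : Fin 9, 2 ≤ (i : ℕ) ∧ (i : ℕ) ≤ 6 ∧ y = Sum.inl i ∧ x = Sum.inr i))) :=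
  Iff.rfl

instance : DecidableRel graphX.Adj := fun x y => decidable_of_iff' _ (adj_iff x y)

/-- The column among `2, …, 6` nearest to column `i`. -/
def rung (i : Fin 9) : Fin 9 := max 2 (min i 6)

/-- The distance in `graphX`. -/
def distance : Fin 9 ⊕ Fin 9 → Fin 9 ⊕ Fin 9 → ℕ
  | Sum.inl i, Sum.inl j | Sum.inr i, Sum.inr j => Nat.dist i j
  | Sum.inl i, Sum.inr j | Sum.inr i, Sum.inl j => Nat.dist i (rung i) + 1 + Nat.dist (rung i) j

theorem exists_walk_of_add {G : SimpleGraph (Fin 9 ⊕ Fin 9)} {f : Fin 9 → Fin 9 ⊕ Fin 9}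
    (hf : ∀ i : Fin 9, (i : ℕ) ≤ 7 → G.Adj (f i) (f (i + 1))) (n : ℕ) :
    ∀ i j : Fin 9, (j : ℕ) = i + n → ∃ p : G.Walk (f i) (f j), p.length = n := by
  induction n with
  | zero =>
    intro i j h
    obtain rfl : j = i := Fin.ext h
    exact ⟨.nil, rfl⟩
  | succ n ih =>
    intro i j h
    have hi : (i : ℕ) ≤ 7 := by omega
    have hi1 : ((i + 1 : Fin 9) : ℕ) = i + 1 := by
      rw [Fin.val_add, Fin.val_one, Nat.mod_eq_of_lt (by omega)]
    obtain ⟨p, hp⟩ := ih (i + 1) j (by omega)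
    exact ⟨.cons (hf i hi) p, by rw [SimpleGraph.Walk.length_cons, hp]⟩

theorem exists_walk_dist {G : SimpleGraph (Fin 9 ⊕ Fin 9)} {f : Fin 9 → Fin 9 ⊕ Fin 9}
    (hf : ∀ i : Fin 9, (i : ℕ) ≤ 7 → G.Adj (f i) (f (i + 1))) (i j : Fin 9) :
    ∃ p : G.Walk (f i) (f j), p.length = Nat.dist i j := by
  rcases le_total (i : ℕ) j with h | h
  · exact exists_walk_of_add hf _ i j (by rw [Nat.dist_eq_sub_of_le h]; omega)
  · obtain ⟨p, hp⟩ := exists_walk_of_add hf (Nat.dist i j) j i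
      (by rw [Nat.dist_eq_sub_of_le_right h]; omega)
    exact ⟨p.reverse, by rw [SimpleGraph.Walk.length_reverse, hp]⟩

theorem adj_inl_succ : ∀ i : Fin 9, (i : ℕ) ≤ 7 → graphX.Adj (Sum.inl i) (Sum.inl (i + 1)) := by
  decide +kernel

theorem adj_inr_succ : ∀ i : Fin 9, (i : ℕ) ≤ 7 → graphX.Adj (Sum.inr i) (Sum.inr (i + 1)) := by
  decide +kernel

theorem adj_rung : ∀ i : Fin 9, graphX.Adj (Sum.inl (rung i)) (Sum.inr (rung i)) := by
  decide +kernel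

theorem exists_walk_length_le_distance (x y : Fin 9 ⊕ Fin 9) :
    ∃ p : graphX.Walk x y, p.length ≤ distance x y := by
  rcases x with i | i <;> rcases y with j | j
  · exact (exists_walk_dist adj_inl_succ i j).imp fun p hp => hp.le
  · obtain ⟨p, hp⟩ := exists_walk_dist adj_inl_succ i (rung i)
    obtain ⟨q, hq⟩ := exists_walk_dist adj_inr_succ (rung i) j
    exact ⟨p.append (.cons (adj_rung i) q), by simp [hp, hq, distance]; omega⟩
  · obtain ⟨p, hp⟩ := exists_walk_dist adj_inr_succ i (rung i)
    obtain ⟨q, hq⟩ := exists_walk_dist adj_inl_succ (rung i) j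
    exact ⟨p.append (.cons (adj_rung i).symm q), by simp [hp, hq, distance]; omega⟩
  · exact (exists_walk_dist adj_inr_succ i j).imp fun p hp => hp.le

/-- The neighbours in `graphX` of a vertex in one of the columns `2, …, 6`. -/
def neighbours : Fin 9 ⊕ Fin 9 → List (Fin 9 ⊕ Fin 9)
  | Sum.inl i => [Sum.inl (i - 1), Sum.inl (i + 1), Sum.inr i]
  | Sum.inr i => [Sum.inr (i - 1), Sum.inr (i + 1), Sum.inl i]

theorem mem_neighbours : ∀ i : Fin 9, 3 ≤ (i : ℕ) → (i : ℕ) ≤ 5 → ∀ c ∈ [Sum.inl i, Sum.inr i],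
    ∀ w, graphX.Adj c w ↔ w ∈ neighbours c := by
  decide +kernel

/-- The partial colouring `a` gives colour `2` to `c` and colours `3`, `4`, `5` to its
neighbours. -/
def IsTwoAmong345 (a : List ((Fin 9 ⊕ Fin 9) × ℕ)) (c : Fin 9 ⊕ Fin 9) : Prop :=
  (c, 2) ∈ a ∧ (∀ w ∈ neighbours c, ∃ k ∈ [3, 4, 5], (w, k) ∈ a) ∧
    ∀ k ∈ [3, 4, 5], ∃ w ∈ neighbours c, (w, k) ∈ a

instance (a : List ((Fin 9 ⊕ Fin 9) × ℕ)) (c : Fin 9 ⊕ Fin 9) : Decidable (IsTwoAmong345 a c) :=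
  inferInstanceAs (Decidable (_ ∧ _ ∧ _))

/-- The partial colouring `a` uses colour `1` in column `i`, or it has a vertex of colour `2` in
column `i` whose neighbours have colours `3`, `4`, `5`. -/
def IsSettled (i : Fin 9) (a : List ((Fin 9 ⊕ Fin 9) × ℕ)) : Prop :=
  ∃ c ∈ [Sum.inl i, Sum.inr i], (c, 1) ∈ a ∨ IsTwoAmong345 a c

instance (i : Fin 9) : DecidablePred (IsSettled i) := fun _ =>
  inferInstanceAs (Decidable (∃ c ∈ [Sum.inl i, Sum.inr i], _ ∨ _))

/-- Vertices of `graphX` by increasing distance of their column from column `i`. -/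
def searchOrder (i : Fin 9) : List (Fin 9 ⊕ Fin 9) :=
  [i, i - 1, i + 1, i - 2, i + 2, i - 3, i + 3].flatMap fun j => [Sum.inl j, Sum.inr j]

theorem packingSearch_searchOrder : ∀ i : Fin 9, 3 ≤ (i : ℕ) → (i : ℕ) ≤ 5 →
    packingSearch distance 5 (fun a => decide (IsSettled i a)) (searchOrder i) [] := by
  decide +kernel

end graphX

open graphX in
theorem graphX_colour_two (π : Fin 9 ⊕ Fin 9 → ℕ)
    (hπ : IsPackingColoring graphX 5 π) (i : Fin 9) (hi3 : 3 ≤ (i : ℕ)) (hi5 : (i : ℕ) ≤ 5)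
    (hu : π (Sum.inl i) ≠ 1) (hv : π (Sum.inr i) ≠ 1) :
    ∃ c ∈ ({Sum.inl i, Sum.inr i} : Set (Fin 9 ⊕ Fin 9)),
      π c = 2 ∧ π '' {w | graphX.Adj c w} = {3, 4, 5} := by
  obtain ⟨a, ha, hπa⟩ := hπ.exists_of_packingSearch exists_walk_length_le_distance
    (packingSearch_searchOrder i hi3 hi5) (by simp)
  obtain ⟨c, hc, h⟩ := of_decide_eq_true ha
  rcases h with h | ⟨h2, hsub, hsup⟩
  · have := hπa _ h
    simp only [List.mem_cons, List.not_mem_nil, or_false] at hc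
    rcases hc with rfl | rfl <;> contradiction
  refine ⟨c, by simpa using hc, hπa _ h2, Set.Subset.antisymm ?_ ?_⟩
  · rintro _ ⟨w, hw, rfl⟩
    obtain ⟨k, hk, hwk⟩ := hsub w ((mem_neighbours i hi3 hi5 c hc w).1 hw)
    rw [hπa _ hwk]
    simpa using hk
  · intro k hk
    obtain ⟨w, hw, hwk⟩ := hsup k (by simpa using hk)
    exact ⟨w, (mem_neighbours i hi3 hi5 c hc w).2 hw, hπa _ hwk⟩
end

section
/- Let n ≥ 6 be an integer. If the circular ladder CL_n admits a packing 5-colouring, then it admits a packing 5-colouring in which every edge of CL_n has at least one endpoint of colour 1. -/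
/-- The circular ladder `CLₙ = Cₙ □ K₂`: vertices `uᵢ = Sum.inl i` and `vᵢ = Sum.inr i`
(`i : ZMod n`), with edges `uᵢuᵢ₊₁`, `vᵢvᵢ₊₁` and `uᵢvᵢ`. -/
def circularLadder (n : ℕ) : SimpleGraph (ZMod n ⊕ ZMod n) :=
  SimpleGraph.fromRel (fun x y =>
    (∃ i : ZMod n, x = Sum.inl i ∧ y = Sum.inl (i + 1)) ∨
    (∃ i : ZMod n, x = Sum.inr i ∧ y = Sum.inr (i + 1)) ∨
    (∃ i : ZMod n, x = Sum.inl i ∧ y = Sum.inr i))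

namespace CircularLadder

/-- Two columns of a ladder at horizontal distance `d` (each given by its upper and lower colour)
can occur together in a packing colouring. -/
def compatible (d : ℕ) (x y : ℕ × ℕ) : Bool :=
  (x.1 != y.1 || x.1.blt d) && (x.2 != y.2 || x.2.blt d) &&
    (x.1 != y.2 || x.1.ble d) && (x.2 != y.1 || x.2.ble d)

/-- The column `c` is compatible with all columns of `w`, which start at distance `d` from `c`. -/
def fits (c : ℕ × ℕ) : ℕ → List (ℕ × ℕ) → Bool
  | _, [] => true
  | d, x :: w => compatible d c x && fits c (d + 1) w

/-- The possible columns of a packing `5`-colouring of a ladder. -/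
def columns : List (ℕ × ℕ) :=
  [(1, 2), (1, 3), (1, 4), (1, 5), (2, 1), (2, 3), (2, 4), (2, 5), (3, 1), (3, 2), (3, 4), (3, 5),
    (4, 1), (4, 2), (4, 3), (4, 5), (5, 1), (5, 2), (5, 3), (5, 4)]

/-- All packing `5`-colourings of `m` consecutive columns. -/
def windows : ℕ → List (List (ℕ × ℕ))
  | 0 => [[]]
  | m + 1 => (windows m).flatMap fun w => (columns.filter fun c => fits c 1 w).map (· :: w)

/-- The `m` consecutive columns of `f` that start at index `i`. -/
def window (f : ℕ → ℕ × ℕ) : ℕ → ℕ → List (ℕ × ℕ)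
  | 0, _ => []
  | m + 1, i => f i :: window f m (i + 1)

/-- Replace the colour `2` by `1` in a column that does not contain the colour `1`. -/
def recolour (x : ℕ × ℕ) : ℕ × ℕ :=
  if x.1 == 1 || x.2 == 1 then x
  else if x.1 == 2 then (1, x.2) else if x.2 == 2 then (x.1, 1) else x

/-- Both columns contain the colour `1` exactly once, in opposite rows. -/
def alternating (x y : ℕ × ℕ) : Bool :=
  (x.1 == 1 && x.2 != 1 && y.1 != 1 && y.2 == 1) ||
    (x.1 != 1 && x.2 == 1 && y.1 == 1 && y.2 != 1)

/-- The columns at positions `2` and `3` alternate after recolouring. -/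
def alternatingAtTwo : List (ℕ × ℕ) → Bool
  | _ :: _ :: x :: y :: _ => alternating (recolour x) (recolour y)
  | _ => false

theorem forall_windows_alternatingAtTwo : (windows 8).all alternatingAtTwo = true := by
  decide +kernel

theorem fits_window {f : ℕ → ℕ × ℕ}
    (hf : ∀ i d, 1 ≤ d → compatible d (f i) (f (i + d)) = true)
    (i m d : ℕ) (hd : 1 ≤ d) : fits (f i) d (window f m (i + d)) = true := by
  induction m generalizing d with
  | zero => rfl
  | succ m ih => simp [window, fits, hf i d hd, add_assoc, ih (d + 1) (by omega)]

theorem window_mem_windows {f : ℕ → ℕ × ℕ}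
    (hf : ∀ i d, 1 ≤ d → compatible d (f i) (f (i + d)) = true)
    (hcol : ∀ i, f i ∈ columns) (m i : ℕ) : window f m i ∈ windows m := by
  induction m generalizing i with
  | zero => simp [window, windows]
  | succ m ih =>
    simp only [windows, List.mem_flatMap]
    exact ⟨_, ih (i + 1), by simp [window, hcol i, fits_window hf i m 1 le_rfl]⟩

theorem alternating_recolour {f : ℕ → ℕ × ℕ}
    (hf : ∀ i d, 1 ≤ d → compatible d (f i) (f (i + d)) = true)
    (hcol : ∀ i, f i ∈ columns) (i : ℕ) :
    alternating (recolour (f (i + 2))) (recolour (f (i + 3))) = true :=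
  List.all_eq_true.1 forall_windows_alternatingAtTwo _ (window_mem_windows hf hcol 8 i)

variable {n : ℕ}

theorem adj_inl (hn : 2 ≤ n) (i : ZMod n) :
    (circularLadder n).Adj (Sum.inl i) (Sum.inl (i + 1)) := by
  have : Fact (1 < n) := ⟨hn⟩
  simp [circularLadder]

theorem adj_inr (hn : 2 ≤ n) (i : ZMod n) :
    (circularLadder n).Adj (Sum.inr i) (Sum.inr (i + 1)) := by
  have : Fact (1 < n) := ⟨hn⟩
  simp [circularLadder]

theorem adj_inl_inr (i : ZMod n) : (circularLadder n).Adj (Sum.inl i) (Sum.inr i) := by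
  simp [circularLadder]

theorem exists_walk_inl (hn : 2 ≤ n) (i : ZMod n) (d : ℕ) :
    ∃ p : (circularLadder n).Walk (Sum.inl i) (Sum.inl (i + d)), p.length = d := by
  induction d with
  | zero => exact ⟨SimpleGraph.Walk.nil.copy rfl (by simp), by simp⟩
  | succ d ih =>
    obtain ⟨p, hp⟩ := ih
    exact ⟨(p.concat (adj_inl hn _)).copy rfl (by push_cast; rw [add_assoc]), by simp [hp]⟩

theorem exists_walk_inr (hn : 2 ≤ n) (i : ZMod n) (d : ℕ) :
    ∃ p : (circularLadder n).Walk (Sum.inr i) (Sum.inr (i + d)), p.length = d := by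
  induction d with
  | zero => exact ⟨SimpleGraph.Walk.nil.copy rfl (by simp), by simp⟩
  | succ d ih =>
    obtain ⟨p, hp⟩ := ih
    exact ⟨(p.concat (adj_inr hn _)).copy rfl (by push_cast; rw [add_assoc]), by simp [hp]⟩

/-- The colours of the `i`-th column. -/
def column (π : ZMod n ⊕ ZMod n → ℕ) (i : ZMod n) : ℕ × ℕ := (π (Sum.inl i), π (Sum.inr i))

theorem add_natCast_ne_self {d : ℕ} (hd : 1 ≤ d) (hdn : d < n) (i : ZMod n) : i ≠ i + d := by
  intro h
  have h0 : (d : ZMod n) = 0 := by simpa using h.symm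
  have := Nat.le_of_dvd hd ((ZMod.natCast_eq_zero_iff d n).1 h0)
  omega

theorem compatible_column (hn : 6 ≤ n) {π : ZMod n ⊕ ZMod n → ℕ}
    (hπ : IsPackingColoring (circularLadder n) 5 π) (i : ZMod n) {d : ℕ} (hd : 1 ≤ d) :
    compatible d (column π i) (column π (i + d)) = true := by
  obtain ⟨hb, hw⟩ := hπ
  have hu := hb (Sum.inl i)
  have hv := hb (Sum.inr i)
  obtain ⟨p, hp⟩ := exists_walk_inl (by omega) i d
  obtain ⟨q, hq⟩ := exists_walk_inr (by omega) i d
  have hne (h : d < n) := add_natCast_ne_self hd h i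
  have h1 (h : π (Sum.inl i) = π (Sum.inl (i + d))) : π (Sum.inl i) < d := by
    by_cases hdn : d < n
    · exact hp ▸ hw _ _ (by simpa using hne hdn) h p
    · omega
  have h2 (h : π (Sum.inr i) = π (Sum.inr (i + d))) : π (Sum.inr i) < d := by
    by_cases hdn : d < n
    · exact hq ▸ hw _ _ (by simpa using hne hdn) h q
    · omega
  have h3 (h : π (Sum.inl i) = π (Sum.inr (i + d))) : π (Sum.inl i) ≤ d := by
    have := hw _ _ (by simp) h (p.concat (adj_inl_inr _))
    simp only [SimpleGraph.Walk.length_concat, hp] at this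
    omega
  have h4 (h : π (Sum.inr i) = π (Sum.inl (i + d))) : π (Sum.inr i) ≤ d := by
    have := hw _ _ (by simp) h (q.concat (adj_inl_inr _).symm)
    simp only [SimpleGraph.Walk.length_concat, hq] at this
    omega
  simp only [compatible, column, Bool.and_eq_true, Bool.or_eq_true, bne_iff_ne, Nat.blt_eq,
    Nat.ble_eq]
  tauto

theorem column_mem_columns {π : ZMod n ⊕ ZMod n → ℕ}
    (hπ : IsPackingColoring (circularLadder n) 5 π) (i : ZMod n) : column π i ∈ columns := by
  obtain ⟨hb, hw⟩ := hπ
  obtain ⟨hu, hu'⟩ := hb (Sum.inl i)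
  obtain ⟨hv, hv'⟩ := hb (Sum.inr i)
  have hne : π (Sum.inl i) ≠ π (Sum.inr i) := fun h => by
    have := hw _ _ (by simp) h (adj_inl_inr i).toWalk
    simp only [SimpleGraph.Walk.length_cons, SimpleGraph.Walk.length_nil] at this
    omega
  simp only [column]
  generalize π (Sum.inl i) = a at *
  generalize π (Sum.inr i) = b at *
  clear hw hb
  interval_cases a <;> interval_cases b <;> simp [columns] at hne ⊢

theorem alternating_recolour_column (hn : 6 ≤ n) {π : ZMod n ⊕ ZMod n → ℕ}
    (hπ : IsPackingColoring (circularLadder n) 5 π) (i : ZMod n) :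
    alternating (recolour (column π i)) (recolour (column π (i + 1))) = true := by
  have : NeZero n := ⟨by omega⟩
  have h := alternating_recolour (f := fun k => column π k)
    (fun i d hd => by simpa using compatible_column hn hπ i hd)
    (fun i => column_mem_columns hπ i) (i - 2).val
  have h2 : i - 2 + 3 = i + 1 := by ring
  simpa [h2] using h

/-- Recolour every column of a ladder by `recolour`. -/
def recolouring (π : ZMod n ⊕ ZMod n → ℕ) : ZMod n ⊕ ZMod n → ℕ
  | Sum.inl i => (recolour (column π i)).1
  | Sum.inr i => (recolour (column π i)).2

theorem recolouring_eq (π : ZMod n ⊕ ZMod n → ℕ) (x : ZMod n ⊕ ZMod n) :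
    recolouring π x = 1 ∨ recolouring π x = π x := by
  rcases x with i | i <;> simp only [recolouring, recolour, column] <;> grind

theorem xor_recolouring_of_adj (hn : 6 ≤ n) {π : ZMod n ⊕ ZMod n → ℕ}
    (hπ : IsPackingColoring (circularLadder n) 5 π) {x y : ZMod n ⊕ ZMod n}
    (hxy : (circularLadder n).Adj x y) : Xor (recolouring π x = 1) (recolouring π y = 1) := by
  have key (i : ZMod n) := alternating_recolour_column hn hπ i
  simp only [alternating, Bool.or_eq_true, Bool.and_eq_true, beq_iff_eq, bne_iff_ne] at key
  simp only [circularLadder, SimpleGraph.fromRel_adj] at hxy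
  simp only [Xor]
  rcases hxy.2 with (⟨i, rfl, rfl⟩ | ⟨i, rfl, rfl⟩ | ⟨i, rfl, rfl⟩) |
      (⟨i, rfl, rfl⟩ | ⟨i, rfl, rfl⟩ | ⟨i, rfl, rfl⟩) <;>
    simp only [recolouring] <;> have := key i <;> tauto

theorem isPackingColoring_recolouring (hn : 6 ≤ n) {π : ZMod n ⊕ ZMod n → ℕ}
    (hπ : IsPackingColoring (circularLadder n) 5 π) :
    IsPackingColoring (circularLadder n) 5 (recolouring π) := by
  refine ⟨fun v => ?_, fun u v huv h p => ?_⟩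
  · have := hπ.1 v
    rcases recolouring_eq π v with h | h <;> omega
  · by_cases h1 : recolouring π u = 1
    · rw [h1]
      by_contra! hp
      have hp0 : p.length ≠ 0 := fun h0 => huv (SimpleGraph.Walk.eq_of_length_eq_zero h0)
      have hadj := SimpleGraph.Walk.adj_of_length_eq_one (p := p) (by omega)
      have := xor_recolouring_of_adj hn hπ hadj
      simp [h1, ← h] at this
    · have hu := (recolouring_eq π u).resolve_left h1
      have hv := (recolouring_eq π v).resolve_left (h ▸ h1)
      rw [hu]
      exact hπ.2 u v huv (by omega) p

end CircularLadder

theorem circularLadder_exists_colour_one_on_edges (n : ℕ) (hn : 6 ≤ n)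
    (h : ∃ π : ZMod n ⊕ ZMod n → ℕ, IsPackingColoring (circularLadder n) 5 π) :
    ∃ π : ZMod n ⊕ ZMod n → ℕ, IsPackingColoring (circularLadder n) 5 π ∧
      ∀ x y : ZMod n ⊕ ZMod n, (circularLadder n).Adj x y → π x = 1 ∨ π y = 1 := by
  obtain ⟨π, hπ⟩ := h
  exact ⟨CircularLadder.recolouring π, CircularLadder.isPackingColoring_recolouring hn hπ,
    fun _ _ hxy => Xor.or (CircularLadder.xor_recolouring_of_adj hn hπ hxy)⟩
end

section
/- For every odd integer n ≥ 7, the packing chromatic number of the circular ladder CL_n is at least 6. -/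
/-- A colouring `f` of the one-way infinite ladder (`f r j` is the colour of the vertex of row `r`
in column `j`) by `{1, …, 5}` in which vertices of equal colour `i` are at distance more than `i`. -/
structure IsLadderPacking (f : Bool → ℕ → ℕ) : Prop where
  one_le : ∀ r j, 1 ≤ f r j
  le_five : ∀ r j, f r j ≤ 5
  rung : ∀ r j, f r j ≠ f (!r) j
  same_row : ∀ r j d, 0 < d → f r j = f r (j + d) → f r j < d
  other_row : ∀ r j d, 0 < d → f r j = f (!r) (j + d) → f r j < d + 1

/-- Column `c`, placed `d` columns after the head of `w`, does not conflict with the columns in `w`,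
where `w` lists consecutive columns from right to left. -/
def columnFits : ℕ → List (ℕ × ℕ) → ℕ × ℕ → Bool
  | _, [], _ => true
  | d, a :: w, c =>
    (a.1 != c.1 || Nat.blt a.1 d) && (a.2 != c.2 || Nat.blt a.2 d) &&
      (a.1 != c.2 || Nat.ble a.1 d) && (a.2 != c.1 || Nat.ble a.2 d) && columnFits (d + 1) w c

/-- Backtracking search: the partial colouring `w` extends by `t` columns such that column `j`
satisfies `p j`. -/
def canExtend (p : ℕ → ℕ × ℕ → Bool) : ℕ → List (ℕ × ℕ) → Bool
  | 0, _ => true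
  | t + 1, w => [1, 2, 3, 4, 5].any fun x => [1, 2, 3, 4, 5].any fun y =>
      x != y && p w.length (x, y) && columnFits 1 w (x, y) && canExtend p t ((x, y) :: w)

/-- The columns `m, …, m + k - 1` of `f`, from right to left, read with row `r` on top. -/
def ladderWindow (f : Bool → ℕ → ℕ) (r : Bool) (m : ℕ) : ℕ → List (ℕ × ℕ)
  | 0 => []
  | k + 1 => (f r (m + k), f (!r) (m + k)) :: ladderWindow f r m k

theorem length_ladderWindow (f : Bool → ℕ → ℕ) (r : Bool) (m k : ℕ) :
    (ladderWindow f r m k).length = k := by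
  induction k with
  | zero => rfl
  | succ k ih => simp [ladderWindow, ih]

/-- The first row has colour 1 in the second column, but colour 1 appears neither diagonally in the
next column nor in the same row two columns later. -/
def skipPattern : ℕ → ℕ × ℕ → Bool
  | 1, c => c.1 == 1
  | 2, c => c.2 != 1
  | 3, c => c.1 != 1
  | _, _ => true

/-- Colour 1 is absent from the second and the third column. -/
def gapPattern : ℕ → ℕ × ℕ → Bool
  | 1, c => c.1 != 1 && c.2 != 1
  | 2, c => c.1 != 1 && c.2 != 1
  | _, _ => true

theorem canExtend_skipPattern : canExtend skipPattern 8 [] = false := rfl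

theorem canExtend_gapPattern : canExtend gapPattern 5 [] = false := rfl

namespace IsLadderPacking

variable {f : Bool → ℕ → ℕ}

theorem columnFits_ladderWindow (hf : IsLadderPacking f) (r : Bool) (m k e : ℕ) :
    columnFits (e + 1) (ladderWindow f r m k) (f r (m + k + e), f (!r) (m + k + e)) = true := by
  induction k generalizing e with
  | zero => rfl
  | succ k ih =>
    have h := ih (e + 1)
    have e1 : m + k + (e + 1) = m + (k + 1) + e := by ring
    have h1 := hf.same_row r (m + k) (e + 1) (by omega)
    have h2 := hf.same_row (!r) (m + k) (e + 1) (by omega)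
    have h3 := hf.other_row r (m + k) (e + 1) (by omega)
    have h4 := hf.other_row (!r) (m + k) (e + 1) (by omega)
    simp only [Bool.not_not, e1] at h h1 h2 h3 h4
    simp only [ladderWindow, columnFits, h, Bool.and_eq_true, Bool.or_eq_true, bne_iff_ne,
      Nat.blt_eq, Nat.ble_eq, and_true]
    exact ⟨⟨⟨by tauto, by tauto⟩, by omega⟩, by omega⟩

theorem canExtend_ladderWindow (hf : IsLadderPacking f) {p : ℕ → ℕ × ℕ → Bool} {r : Bool} {m : ℕ}
    (hp : ∀ j, p j (f r (m + j), f (!r) (m + j)) = true) (t k : ℕ) :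
    canExtend p t (ladderWindow f r m k) = true := by
  have mem : ∀ s j, f s j ∈ [1, 2, 3, 4, 5] := fun s j => by
    have := hf.one_le s j
    have := hf.le_five s j
    simp only [List.mem_cons, List.not_mem_nil, or_false]
    omega
  induction t generalizing k with
  | zero => rfl
  | succ t ih =>
    refine List.any_eq_true.2 ⟨_, mem r (m + k), List.any_eq_true.2 ⟨_, mem (!r) (m + k), ?_⟩⟩
    simp only [length_ladderWindow, Bool.and_eq_true, bne_iff_ne]
    exact ⟨⟨⟨hf.rung r _, hp k⟩, hf.columnFits_ladderWindow r m k 0⟩, ih (k + 1)⟩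

theorem exists_one (hf : IsLadderPacking f) : ∃ r j, 0 < j ∧ f r j = 1 := by
  by_contra! h
  have := hf.canExtend_ladderWindow (p := gapPattern) (r := false) (m := 0) (fun j => by
    unfold gapPattern
    split <;> simp [h]) 5 0
  exact Bool.false_ne_true (canExtend_gapPattern.symm.trans this)

theorem one_next (hf : IsLadderPacking f) {r : Bool} {j : ℕ} (hj : 0 < j) (h : f r j = 1) :
    f (!r) (j + 1) = 1 ∨ f r (j + 2) = 1 := by
  by_contra! hne
  obtain ⟨m, rfl⟩ : ∃ m, j = m + 1 := ⟨j - 1, by omega⟩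
  have := hf.canExtend_ladderWindow (p := skipPattern) (r := r) (m := m) (fun j => by
    unfold skipPattern
    split
    · simp [h]
    · simpa using hne.1
    · simpa using hne.2
    · rfl) 8 0
  exact Bool.false_ne_true (canExtend_skipPattern.symm.trans this)

/-- Up to skipped columns, colour 1 alternates between the rows. -/
theorem one_alternates (hf : IsLadderPacking f) {r : Bool} {j : ℕ} (hj : 0 < j)
    (h : f r j = 1) (t : ℕ) :
    f (r ^^ t.bodd) (j + t) = 1 ∨ f (!(r ^^ t.bodd)) (j + t + 1) = 1 := by
  induction t with
  | zero => simp [h]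
  | succ t ih =>
    simp only [Nat.bodd_succ, Bool.xor_not, Bool.not_not]
    rcases ih with h1 | h1
    · exact hf.one_next (Nat.add_pos_left hj t) h1
    · exact Or.inl h1

theorem not_periodic_odd (hf : IsLadderPacking f) {n : ℕ} (hn : Odd n)
    (hper : ∀ r j, f r (j + n) = f r j) : False := by
  obtain ⟨r, j, hj, h⟩ := hf.exists_one
  have hb : n.bodd = true := by
    obtain ⟨k, rfl⟩ := hn
    simp [Nat.bodd_mul, show Nat.bodd 2 = false from rfl]
  rcases hf.one_alternates hj h n with h1 | h1
  · rw [hper, hb, Bool.xor_true] at h1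
    exact hf.rung r j (h.trans h1.symm)
  · rw [hb, Bool.xor_true, Bool.not_not, show j + n + 1 = j + 1 + n by ring, hper] at h1
    exact absurd (hf.same_row r j 1 one_pos (h.trans h1.symm)) (by omega)

end IsLadderPacking

/-- The vertex of `circularLadder n` in row `r` and column `i`. -/
def ladderVertex {n : ℕ} (r : Bool) (i : ZMod n) : ZMod n ⊕ ZMod n :=
  bif r then Sum.inr i else Sum.inl i

theorem ladderVertex_inj {n : ℕ} {r s : Bool} {i j : ZMod n} :
    ladderVertex r i = ladderVertex s j ↔ r = s ∧ i = j := by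
  cases r <;> cases s <;> simp [ladderVertex]

theorem circularLadder_adj_rung {n : ℕ} (r : Bool) (i : ZMod n) :
    (circularLadder n).Adj (ladderVertex r i) (ladderVertex (!r) i) := by
  cases r <;> simp [circularLadder, ladderVertex]

theorem circularLadder_adj_succ {n : ℕ} (hn : 1 < n) (r : Bool) (i : ZMod n) :
    (circularLadder n).Adj (ladderVertex r i) (ladderVertex r (i + 1)) := by
  have : Fact (1 < n) := ⟨hn⟩
  cases r <;> simp [circularLadder, ladderVertex]

theorem circularLadder_exists_walk {n : ℕ} (hn : 1 < n) (r : Bool) (i : ZMod n) (d : ℕ) :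
    ∃ p : (circularLadder n).Walk (ladderVertex r i) (ladderVertex r (i + d)), p.length = d := by
  induction d with
  | zero => exact ⟨SimpleGraph.Walk.nil.copy rfl (by simp), by simp⟩
  | succ d ih =>
    obtain ⟨p, hp⟩ := ih
    exact ⟨(p.concat (circularLadder_adj_succ hn r _)).copy rfl (by push_cast; rw [add_assoc]),
      by simp [hp]⟩

/-- Unrolling a packing 5-colouring of a circular ladder. -/
theorem IsPackingColoring.isLadderPacking {n k : ℕ} (hn : 6 ≤ n) (hk : k ≤ 5)
    {π : ZMod n ⊕ ZMod n → ℕ} (hπ : IsPackingColoring (circularLadder n) k π) :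
    IsLadderPacking fun r j => π (ladderVertex r (j : ZMod n)) := by
  have le_five : ∀ v, π v ≤ 5 := fun v => (hπ.1 v).2.trans hk
  have cast_ne : ∀ {d : ℕ} (j : ℕ), 0 < d → d < n → (j : ZMod n) ≠ ((j + d : ℕ) : ZMod n) := by
    intro d j h0 hd h
    rw [Nat.cast_add, left_eq_add, ZMod.natCast_eq_zero_iff] at h
    exact absurd (Nat.le_of_dvd h0 h) (by omega)
  refine ⟨fun r j => (hπ.1 _).1, fun r j => le_five _, fun r j h => ?_, fun r j d hd h => ?_,
    fun r j d hd h => ?_⟩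
  · have := hπ.2 _ _ (circularLadder_adj_rung r _).ne h (circularLadder_adj_rung r _).toWalk
    exact absurd this (hπ.1 _).1.not_gt
  · by_cases hdn : d < n
    · obtain ⟨p, hp⟩ := circularLadder_exists_walk (by omega) r (j : ZMod n) d
      have := hπ.2 _ _ (fun e => cast_ne j hd hdn (ladderVertex_inj.1 e).2) h
        (p.copy rfl (by rw [Nat.cast_add]))
      simpa [hp] using this
    · have := le_five (ladderVertex r (j : ZMod n))
      omega
  · obtain ⟨p, hp⟩ := circularLadder_exists_walk (by omega) r (j : ZMod n) d
    have := hπ.2 _ _ (fun e => by simpa using (ladderVertex_inj.1 e).1) h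
      ((p.concat (circularLadder_adj_rung r _)).copy rfl (by rw [Nat.cast_add]))
    simpa [hp] using this

theorem SimpleGraph.exists_isPackingColoring {V : Type*} [Finite V] (G : SimpleGraph V) :
    ∃ k, ∃ π : V → ℕ, IsPackingColoring G k π := by
  obtain ⟨k, ⟨e⟩⟩ := Finite.exists_equiv_fin V
  refine ⟨k, fun v => e v + 1, fun v => ⟨Nat.le_add_left _ _, (e v).isLt⟩, fun u v huv h => ?_⟩
  exact absurd (e.injective (Fin.ext (by simpa using h))) huv

theorem circularLadder_odd_ge_six (n : ℕ) (hn : 7 ≤ n) (hodd : Odd n) :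
    6 ≤ packingChromaticNumber (circularLadder n) := by
  have : NeZero n := ⟨by omega⟩
  obtain ⟨π, hπ⟩ := Nat.sInf_mem (circularLadder n).exists_isPackingColoring
  by_contra! hlt
  have hf := IsPackingColoring.isLadderPacking (Nat.le_of_succ_le hn) (Nat.le_of_lt_succ hlt) hπ
  exact hf.not_periodic_odd hodd fun r j => by simp
end

section
/- For every integer r ≥ 3 and every packing 5-colouring π of the H-graph H(r), for every i with 0 ≤ i ≤ r−1 the set of colours used by π on the vertices of G_i(r) intersected with the set of colours used by π on the vertices of G_{i+1}(r) (indices modulo r) equals {1,2,3}. -/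
/-- The H-graph `H(r)`: vertices `uᵢ = (0, i)`, `vᵢ = (1, i)`, `wᵢ = (2, i)` for
`i : ZMod (2*r)`, with edges `uᵢuᵢ₊₁`, `wᵢwᵢ₊₁`, `uᵢvᵢ`, `vᵢwᵢ` (for all `i`) and
`v_{2j}v_{2j+1}` for `0 ≤ j ≤ r-1`. -/
def Hgraph (r : ℕ) : SimpleGraph (Fin 3 × ZMod (2 * r)) :=
  SimpleGraph.fromRel (fun x y =>
    (∃ i : ZMod (2 * r), x = ((0 : Fin 3), i) ∧ y = ((0 : Fin 3), i + 1)) ∨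
    (∃ i : ZMod (2 * r), x = ((2 : Fin 3), i) ∧ y = ((2 : Fin 3), i + 1)) ∨
    (∃ i : ZMod (2 * r), x = ((0 : Fin 3), i) ∧ y = ((1 : Fin 3), i)) ∨
    (∃ i : ZMod (2 * r), x = ((1 : Fin 3), i) ∧ y = ((2 : Fin 3), i)) ∨
    (∃ j : ℕ, j < r ∧ x = ((1 : Fin 3), ((2 * j : ℕ) : ZMod (2 * r))) ∧
      y = ((1 : Fin 3), ((2 * j + 1 : ℕ) : ZMod (2 * r)))))

/-- The vertex set of the subgraph `G_i(r)` of `H(r)`, namely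
`{u_{2i}, u_{2i+1}, v_{2i}, v_{2i+1}, w_{2i}, w_{2i+1}}`. -/
def GiVerts (r i : ℕ) : Set (Fin 3 × ZMod (2 * r)) :=
  {((0 : Fin 3), ((2 * i : ℕ) : ZMod (2 * r))), ((0 : Fin 3), ((2 * i + 1 : ℕ) : ZMod (2 * r))),
   ((1 : Fin 3), ((2 * i : ℕ) : ZMod (2 * r))), ((1 : Fin 3), ((2 * i + 1 : ℕ) : ZMod (2 * r))),
   ((2 : Fin 3), ((2 * i : ℕ) : ZMod (2 * r))), ((2 : Fin 3), ((2 * i + 1 : ℕ) : ZMod (2 * r)))}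

/-- Backtracking over all assignments of colours from `colours` to the list of points, pruning
those in which two points `x`, `y` of equal colour `c` satisfy `conflict x y c`. The result is
`true` iff every surviving assignment, prepended to the given partial one, passes `test`. -/
def allColourings {α : Type*} (colours : List ℕ) (conflict : α → α → ℕ → Bool)
    (test : List (α × ℕ) → Bool) : List α → List (α × ℕ) → Bool
  | [], acc => test acc
  | x :: xs, acc => colours.all fun c =>
      acc.any (fun p => p.2 == c && conflict p.1 x c) ||
        allColourings colours conflict test xs ((x, c) :: acc)

theorem test_of_allColourings {α : Type*} {colours : List ℕ} {conflict : α → α → ℕ → Bool}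
    {test : List (α × ℕ) → Bool} {f : α → ℕ} (hmem : ∀ x, f x ∈ colours)
    (hf : ∀ x y, f x = f y → conflict x y (f y) = false) (xs ys : List α)
    (h : allColourings colours conflict test xs (ys.map fun x => (x, f x)) = true) :
    test ((xs.reverse ++ ys).map fun x => (x, f x)) = true := by
  induction xs generalizing ys with
  | nil => simpa [allColourings] using h
  | cons x xs ih =>
    rw [allColourings, List.all_eq_true] at h
    have hx := h (f x) (hmem x)
    rw [Bool.or_eq_true] at hx
    rcases hx with hx | hx
    · simp only [List.any_map, List.any_eq_true, Function.comp_apply, Bool.and_eq_true,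
        beq_iff_eq] at hx
      obtain ⟨y, -, hy, hc⟩ := hx
      simp [hf y x hy] at hc
    · simpa using ih (x :: ys) (by simpa using hx)

/-- The distance between two vertices, given by row and column, of the infinite strip covering
the H-graphs. -/
def stripDist (x y : Fin 3 × ℕ) : ℕ :=
  (x.2 - y.2) + (y.2 - x.2) +
    if x.1 = 1 ∧ y.1 = 1 then (if x.2 / 2 = y.2 / 2 then 0 else 2)
    else (x.1.val - y.1.val) + (y.1.val - x.1.val)

theorem stripDist_comm (x y : Fin 3 × ℕ) : stripDist x y = stripDist y x := by
  simp only [stripDist, and_comm (a := x.1 = 1), eq_comm (a := x.2 / 2)]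
  split_ifs <;> omega

theorem stripDist_self (x : Fin 3 × ℕ) : stripDist x x = 0 := by
  simp [stripDist]

/-- The covering map from the infinite strip to `H(r)`. -/
def stripProj (r : ℕ) (x : Fin 3 × ℕ) : Fin 3 × ZMod (2 * r) := (x.1, (x.2 : ZMod (2 * r)))

theorem natCast_ne_natCast_of_lt {N m n : ℕ} (h : m < n) (h' : n < m + N) :
    (m : ZMod N) ≠ n := by
  intro e
  have hd := (Nat.modEq_iff_dvd' h.le).1 ((ZMod.natCast_eq_natCast_iff m n N).1 e)
  exact absurd (Nat.le_of_dvd (by omega) hd) (by omega)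

theorem stripProj_ne {r : ℕ} {x y : Fin 3 × ℕ} (hxy : x ≠ y) (h : stripDist x y < 2 * r) :
    stripProj r x ≠ stripProj r y := by
  obtain ⟨a, m⟩ := x
  obtain ⟨b, n⟩ := y
  intro e
  simp only [stripProj, Prod.mk.injEq] at e
  obtain ⟨rfl, e⟩ := e
  simp only [stripDist] at h
  rcases lt_trichotomy m n with hmn | rfl | hmn
  · exact natCast_ne_natCast_of_lt hmn (by omega) e
  · exact hxy rfl
  · exact natCast_ne_natCast_of_lt hmn (by omega) e.symm

theorem Hgraph_adj_rim {r : ℕ} (hr : 0 < r) {a : Fin 3} (ha : a ≠ 1) (n : ℕ) :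
    (Hgraph r).Adj (stripProj r (a, n)) (stripProj r (a, n + 1)) := by
  have hne : (n : ZMod (2 * r)) ≠ ((n + 1 : ℕ) : ZMod (2 * r)) :=
    natCast_ne_natCast_of_lt (by omega) (by omega)
  rw [Hgraph, SimpleGraph.fromRel_adj]
  refine ⟨fun e => hne (Prod.mk.inj e).2, Or.inl ?_⟩
  fin_cases a
  · exact Or.inl ⟨n, rfl, by simp [stripProj]⟩
  · exact absurd rfl ha
  · exact Or.inr (Or.inl ⟨n, rfl, by simp [stripProj]⟩)

theorem Hgraph_adj_spoke (r : ℕ) {a : Fin 3} (ha : a ≠ 1) (n : ℕ) :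
    (Hgraph r).Adj (stripProj r (a, n)) (stripProj r (1, n)) := by
  rw [Hgraph, SimpleGraph.fromRel_adj]
  refine ⟨fun e => ha (Prod.mk.inj e).1, ?_⟩
  fin_cases a
  · exact Or.inl (Or.inr (Or.inr (Or.inl ⟨n, rfl, rfl⟩)))
  · exact absurd rfl ha
  · exact Or.inr (Or.inr (Or.inr (Or.inr (Or.inl ⟨n, rfl, rfl⟩))))

theorem Hgraph_adj_middle {r : ℕ} (hr : 0 < r) (k : ℕ) :
    (Hgraph r).Adj (stripProj r (1, 2 * k)) (stripProj r (1, 2 * k + 1)) := by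
  have hne : ((2 * k : ℕ) : ZMod (2 * r)) ≠ ((2 * k + 1 : ℕ) : ZMod (2 * r)) :=
    natCast_ne_natCast_of_lt (by omega) (by omega)
  have hmod : ((2 * k : ℕ) : ZMod (2 * r)) = ((2 * (k % r) : ℕ) : ZMod (2 * r)) := by
    rw [ZMod.natCast_eq_natCast_iff]
    exact ((Nat.mod_modEq k r).mul_left' 2).symm
  rw [Hgraph, SimpleGraph.fromRel_adj]
  refine ⟨fun e => hne (Prod.mk.inj e).2,
    Or.inl (Or.inr (Or.inr (Or.inr (Or.inr ⟨k % r, Nat.mod_lt k hr, ?_, ?_⟩))))⟩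
  · simp only [stripProj, hmod]
  · simp only [stripProj, Nat.cast_succ, hmod]

theorem Hgraph_exists_walk_rim {r : ℕ} (hr : 0 < r) {a : Fin 3} (ha : a ≠ 1) (m k : ℕ) :
    ∃ p : (Hgraph r).Walk (stripProj r (a, m)) (stripProj r (a, m + k)), p.length = k := by
  induction k with
  | zero => exact ⟨.nil, rfl⟩
  | succ k ih =>
    obtain ⟨p, hp⟩ := ih
    exact ⟨p.concat (Hgraph_adj_rim hr ha (m + k)), by simp [hp]⟩

theorem Hgraph_exists_walk_of_le {r : ℕ} (hr : 0 < r) (a b : Fin 3) {m n : ℕ} (hmn : m ≤ n) :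
    ∃ p : (Hgraph r).Walk (stripProj r (a, m)) (stripProj r (b, n)),
      p.length = stripDist (a, m) (b, n) := by
  obtain ⟨k, rfl⟩ := Nat.exists_eq_add_of_le hmn
  by_cases ha : a = 1 <;> by_cases hb : b = 1
  · subst ha hb
    by_cases hblock : m / 2 = (m + k) / 2
    · obtain rfl | ⟨rfl, l, rfl⟩ : k = 0 ∨ k = 1 ∧ ∃ l, m = 2 * l :=
        if hk : k = 0 then .inl hk else .inr ⟨by omega, m / 2, by omega⟩
      · exact ⟨.nil, by simp [stripDist]⟩
      · exact ⟨(Hgraph_adj_middle hr l).toWalk, by simp [stripDist, ← hblock]⟩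
    · obtain ⟨p, hp⟩ := Hgraph_exists_walk_rim hr (a := 0) (by decide) m k
      exact ⟨.cons (Hgraph_adj_spoke r (by decide) m).symm
        (p.concat (Hgraph_adj_spoke r (by decide) (m + k))), by simp [stripDist, hp, hblock]⟩
  · subst ha
    obtain ⟨p, hp⟩ := Hgraph_exists_walk_rim hr hb m k
    refine ⟨.cons (Hgraph_adj_spoke r hb m).symm p, ?_⟩
    fin_cases b <;> first | exact absurd rfl hb | simp [stripDist, hp]
  · subst hb
    obtain ⟨p, hp⟩ := Hgraph_exists_walk_rim hr ha m k
    refine ⟨p.concat (Hgraph_adj_spoke r ha (m + k)), ?_⟩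
    fin_cases a <;> first | exact absurd rfl ha | simp [stripDist, hp]
  · obtain ⟨p, hp⟩ := Hgraph_exists_walk_rim hr ha m k
    by_cases hab : a = b
    · subst hab
      exact ⟨p, by simp [stripDist, hp, ha]⟩
    · refine ⟨(p.concat (Hgraph_adj_spoke r ha (m + k))).concat
        (Hgraph_adj_spoke r hb (m + k)).symm, ?_⟩
      fin_cases a <;> fin_cases b <;>
        first | exact absurd rfl ha | exact absurd rfl hb | exact absurd rfl hab | simp [stripDist, hp]

theorem Hgraph_exists_walk {r : ℕ} (hr : 0 < r) (x y : Fin 3 × ℕ) :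
    ∃ p : (Hgraph r).Walk (stripProj r x) (stripProj r y), p.length = stripDist x y := by
  rcases le_total x.2 y.2 with h | h
  · exact Hgraph_exists_walk_of_le hr x.1 y.1 h
  · obtain ⟨p, hp⟩ := Hgraph_exists_walk_of_le hr y.1 x.1 h
    exact ⟨p.reverse, by rw [SimpleGraph.Walk.length_reverse, hp, stripDist_comm]⟩

/-- The vertices of the infinite strip lying over `G_i(r)`. -/
def stripBlock (i : ℕ) : List (Fin 3 × ℕ) :=
  [(0, 2 * i), (0, 2 * i + 1), (1, 2 * i), (1, 2 * i + 1), (2, 2 * i), (2, 2 * i + 1)]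

theorem stripDist_add_even (s : ℕ) (x y : Fin 3 × ℕ) :
    stripDist (x.1, 2 * s + x.2) (y.1, 2 * s + y.2) = stripDist x y := by
  have h : (2 * s + x.2) / 2 = (2 * s + y.2) / 2 ↔ x.2 / 2 = y.2 / 2 := by omega
  simp only [stripDist, h, Nat.add_sub_add_left]

/-- The search certificate: a packing 5-colouring of four consecutive blocks uses exactly the
colours `1`, `2`, `3` in both of the two middle blocks. -/
theorem allColourings_stripBlock :
    allColourings [1, 2, 3, 4, 5]
      (fun x y c => decide (0 < stripDist x y) && decide (stripDist x y ≤ c))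
      (fun acc =>
        [1, 2, 3, 4, 5].all (fun c =>
          (acc.any (fun p => p.1.2 / 2 == 1 && p.2 == c) &&
            acc.any (fun p => p.1.2 / 2 == 2 && p.2 == c)) == decide (c ≤ 3)) ||
        allColourings [1, 2, 3, 4, 5]
          (fun x y c => decide (0 < stripDist x y) && decide (stripDist x y ≤ c))
          (fun _ => false) (stripBlock 3 ++ stripBlock 0) acc)
      (stripBlock 1 ++ stripBlock 2) [] = true := by
  decide +kernel

theorem strip_consecutive_colour_sets {f : Fin 3 × ℕ → ℕ} (hmem : ∀ x, f x ∈ [1, 2, 3, 4, 5])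
    (hf : ∀ x y, x ≠ y → f x = f y → f x < stripDist x y) {c : ℕ} :
    (c ∈ (stripBlock 1).map f ∧ c ∈ (stripBlock 2).map f) ↔ c ∈ ({1, 2, 3} : Set ℕ) := by
  have hconf : ∀ x y, f x = f y →
      (decide (0 < stripDist x y) && decide (stripDist x y ≤ f y)) = false := by
    intro x y hxy
    by_cases e : x = y
    · simp [e, stripDist_self]
    · have := hf x y e hxy
      simp only [Bool.and_eq_false_iff, decide_eq_false_iff_not]
      omega
  have h := test_of_allColourings hmem hconf _ [] allColourings_stripBlock
  rw [Bool.or_eq_true] at h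
  rcases h with h | h
  · by_cases hc : c ∈ [1, 2, 3, 4, 5]
    · have h := List.all_eq_true.1 h c hc
      have hc3 : c ∈ ({1, 2, 3} : Set ℕ) ↔ c ≤ 3 := by
        simp only [List.mem_cons, List.not_mem_nil, or_false] at hc
        simp only [Set.mem_insert_iff, Set.mem_singleton_iff]
        omega
      have hfilter : ∀ b ∈ [1, 2], ((stripBlock 1 ++ stripBlock 2).reverse ++ []).filter
          (fun x => x.2 / 2 == b) = (stripBlock b).reverse := by decide
      have hany : ∀ b ∈ [1, 2], c ∈ (stripBlock b).map f ↔
          (((stripBlock 1 ++ stripBlock 2).reverse ++ []).map fun x => (x, f x)).any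
            (fun p => p.1.2 / 2 == b && p.2 == c) = true := by
        intro b hb
        rw [List.mem_map]
        simp only [← List.mem_reverse (as := stripBlock b), ← hfilter b hb, List.mem_filter,
          List.any_map, List.any_eq_true, Function.comp_apply, Bool.and_eq_true, beq_iff_eq,
          and_assoc]
      rw [hc3, ← decide_eq_true_iff (p := c ≤ 3), ← beq_iff_eq.1 h, Bool.and_eq_true,
        hany 1 (by simp), hany 2 (by simp)]
    · constructor
      · rintro ⟨h, -⟩
        obtain ⟨x, -, rfl⟩ := List.mem_map.1 h
        exact absurd (hmem x) hc
      · rintro (rfl | rfl | rfl) <;> simp at hc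
  · exact absurd (test_of_allColourings hmem hconf _ _ h) (by simp)

theorem GiVerts_eq_image (r s i : ℕ) :
    GiVerts r (s + i) =
      (fun x : Fin 3 × ℕ => stripProj r (x.1, 2 * s + x.2)) '' {x | x ∈ stripBlock i} := by
  ext y
  simp [GiVerts, stripBlock, stripProj, eq_comm, mul_add, add_assoc]

theorem GiVerts_add_self (r i : ℕ) : GiVerts r (i + r) = GiVerts r i := by
  have h : ((2 * (i + r) : ℕ) : ZMod (2 * r)) = ((2 * i : ℕ) : ZMod (2 * r)) := by
    rw [mul_add, Nat.cast_add, ZMod.natCast_self, add_zero]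
  simp only [GiVerts, Nat.cast_succ, h]

theorem Hgraph_consecutive_colour_sets (r : ℕ) (hr : 3 ≤ r)
    (π : Fin 3 × ZMod (2 * r) → ℕ) (hπ : IsPackingColoring (Hgraph r) 5 π)
    (i : ℕ) (hi : i < r) :
    (π '' GiVerts r i) ∩ (π '' GiVerts r (i + 1)) = {1, 2, 3} := by
  obtain ⟨s, hs⟩ : ∃ s, i + r = s + 1 := ⟨i + r - 1, by omega⟩
  rw [← GiVerts_add_self r i, ← GiVerts_add_self r (i + 1), add_right_comm i 1 r, hs, add_assoc,
    GiVerts_eq_image, GiVerts_eq_image, Set.image_image, Set.image_image]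
  ext c
  rw [← strip_consecutive_colour_sets (f := fun x => π (stripProj r (x.1, 2 * s + x.2)))]
  · simp only [List.mem_map]
    rfl
  · intro x
    have := hπ.1 (stripProj r (x.1, 2 * s + x.2))
    simp only [List.mem_cons, List.not_mem_nil, or_false]
    omega
  · intro x y hxy hc
    by_contra! hlt
    rw [← stripDist_add_even s] at hlt
    have hle := (hπ.1 (stripProj r (x.1, 2 * s + x.2))).2
    obtain ⟨p, hp⟩ := Hgraph_exists_walk (r := r) (by omega) (x.1, 2 * s + x.2) (y.1, 2 * s + y.2)
    have hne : stripProj r (x.1, 2 * s + x.2) ≠ stripProj r (y.1, 2 * s + y.2) := by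
      refine stripProj_ne (fun e => hxy ?_) (by omega)
      rw [Prod.mk.injEq, Nat.add_left_cancel_iff] at e
      exact Prod.ext e.1 e.2
    have := hπ.2 _ _ hne hc p
    omega
end

section
/- For every integer r ≥ 2, the packing chromatic number of the H-graph H(r) equals 5 if r is even, and satisfies 6 ≤ χρ(H(r)) ≤ 7 if r is odd. -/
namespace Hgraph

/-- The distance in the infinite cover of the H-graphs, whose columns are indexed by `ℤ`. -/
def coverDist (a : Fin 3) (i : ℤ) (b : Fin 3) (j : ℤ) : ℕ :=
  if a = 1 ∧ b = 1 then
    if i = j then 0 else if i / 2 = j / 2 then 1 else (i - j).natAbs + 2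
  else (i - j).natAbs + ((a : ℤ) - (b : ℤ)).natAbs

/-! ### Lower bounds on distances -/

lemma coverDist_shift (a b : Fin 3) (i j s : ℤ) :
    coverDist a (i + 2 * s) b (j + 2 * s) = coverDist a i b j := by
  unfold coverDist
  split_ifs <;> omega

/-- Adjacent vertices have adjacent lifts. -/
lemma exists_lift_of_adj {r : ℕ} {x y : Fin 3 × ZMod (2 * r)} (h : (Hgraph r).Adj x y)
    (i : ℤ) (hi : (i : ZMod (2 * r)) = x.2) :
    ∃ j : ℤ, (j : ZMod (2 * r)) = y.2 ∧
      ((x.1 = y.1 ∧ x.1 ≠ 1 ∧ (i - j).natAbs = 1) ∨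
        ((x.1 = 1 ∧ y.1 ≠ 1 ∨ x.1 ≠ 1 ∧ y.1 = 1) ∧ i = j) ∨
        (x.1 = 1 ∧ y.1 = 1 ∧ i / 2 = j / 2)) := by
  have even_of_cast : ∀ k : ℕ, (i : ZMod (2 * r)) = ((2 * k : ℕ) : ZMod (2 * r)) → i % 2 = 0 := by
    intro k hk
    have h2 : (i : ZMod (2 * r)) = ((2 * k : ℕ) : ℤ) := by rw [hk]; push_cast; rfl
    rw [ZMod.intCast_eq_intCast_iff_dvd_sub] at h2
    have : (2 : ℤ) ∣ ((2 * k : ℕ) : ℤ) - i := dvd_trans ⟨r, by push_cast; ring⟩ h2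
    omega
  have odd_of_cast :
      ∀ k : ℕ, (i : ZMod (2 * r)) = ((2 * k + 1 : ℕ) : ZMod (2 * r)) → i % 2 = 1 := by
    intro k hk
    have h2 : (i : ZMod (2 * r)) = ((2 * k + 1 : ℕ) : ℤ) := by rw [hk]; push_cast; rfl
    rw [ZMod.intCast_eq_intCast_iff_dvd_sub] at h2
    have : (2 : ℤ) ∣ ((2 * k + 1 : ℕ) : ℤ) - i := dvd_trans ⟨r, by push_cast; ring⟩ h2
    omega
  rw [Hgraph, SimpleGraph.fromRel_adj] at h
  obtain ⟨-, h | h⟩ := h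
  · obtain ⟨z, rfl, rfl⟩ | ⟨z, rfl, rfl⟩ | ⟨z, rfl, rfl⟩ | ⟨z, rfl, rfl⟩ | ⟨k, -, rfl, rfl⟩ := h
    · exact ⟨i + 1, by simpa using hi, by simp⟩
    · exact ⟨i + 1, by simpa using hi, by simp⟩
    · exact ⟨i, hi, by simp⟩
    · exact ⟨i, hi, by simp⟩
    · have := even_of_cast k hi
      exact ⟨i + 1, by simpa using hi, Or.inr (Or.inr ⟨rfl, rfl, by omega⟩)⟩
  · obtain ⟨z, rfl, rfl⟩ | ⟨z, rfl, rfl⟩ | ⟨z, rfl, rfl⟩ | ⟨z, rfl, rfl⟩ | ⟨k, -, rfl, rfl⟩ := h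
    · exact ⟨i - 1, by simp [hi], by simp⟩
    · exact ⟨i - 1, by simp [hi], by simp⟩
    · exact ⟨i, hi, by simp⟩
    · exact ⟨i, hi, by simp⟩
    · have := odd_of_cast k hi
      exact ⟨i - 1, by simp [hi], Or.inr (Or.inr ⟨rfl, rfl, by omega⟩)⟩

lemma coverDist_le_succ {a a' : Fin 3} {i i' : ℤ}
    (h : (a = a' ∧ a ≠ 1 ∧ (i - i').natAbs = 1) ∨
        ((a = 1 ∧ a' ≠ 1 ∨ a ≠ 1 ∧ a' = 1) ∧ i = i') ∨ (a = 1 ∧ a' = 1 ∧ i / 2 = i' / 2))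
    (b : Fin 3) (j : ℤ) : coverDist a i b j ≤ coverDist a' i' b j + 1 := by
  unfold coverDist
  split_ifs <;> omega

lemma exists_lift_of_walk {r : ℕ} {x y : Fin 3 × ZMod (2 * r)} (p : (Hgraph r).Walk x y)
    (i : ℤ) (hi : (i : ZMod (2 * r)) = x.2) :
    ∃ j : ℤ, (j : ZMod (2 * r)) = y.2 ∧ coverDist x.1 i y.1 j ≤ p.length := by
  induction p generalizing i with
  | nil => exact ⟨i, hi, by unfold coverDist; split_ifs <;> simp_all⟩
  | cons h p ih =>
    obtain ⟨i', hi', h'⟩ := exists_lift_of_adj h i hi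
    obtain ⟨j, hj, hle⟩ := ih i' hi'
    refine ⟨j, hj, (coverDist_le_succ h' _ j).trans ?_⟩
    rw [SimpleGraph.Walk.length_cons]
    omega

/-- A periodic packing colouring of the infinite cover descends to the H-graph. -/
lemma isPackingColoring_of_cover {r k : ℕ} (hr : r ≠ 0) (F : Fin 3 → ℤ → ℕ)
    (hF : ∀ a i, 1 ≤ F a i ∧ F a i ≤ k)
    (hper : ∀ a i j, ((2 * r : ℕ) : ℤ) ∣ j - i → F a i = F a j)
    (hpack : ∀ a b i j, F a i = F b j → coverDist a i b j ≤ F a i →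
      a = b ∧ ((2 * r : ℕ) : ℤ) ∣ j - i) :
    IsPackingColoring (Hgraph r) k (fun x => F x.1 (x.2.val : ℤ)) := by
  have : NeZero (2 * r) := ⟨by omega⟩
  refine ⟨fun v => hF _ _, fun x y hne heq p => ?_⟩
  by_contra! hlen
  obtain ⟨j, hj, hle⟩ := exists_lift_of_walk p (x.2.val : ℤ) (by simp)
  have hdvd : ((2 * r : ℕ) : ℤ) ∣ j - (y.2.val : ℤ) := by
    rw [← ZMod.intCast_eq_intCast_iff_dvd_sub]
    simp [hj]
  have hyj := hper y.1 _ _ hdvd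
  obtain ⟨h1, h2⟩ := hpack x.1 y.1 _ j (heq.trans hyj) (hle.trans hlen)
  refine hne (Prod.ext h1 ?_)
  rw [← ZMod.intCast_eq_intCast_iff_dvd_sub] at h2
  simpa [hj] using h2

/-! ### Colourings -/

/-- A packing `5`-colouring of the infinite cover with period four. -/
def coverColoring (a : Fin 3) (i : ℤ) : ℕ :=
  if a = 0 then if i % 4 = 1 then 2 else if i % 4 = 3 then 3 else 1
  else if a = 1 then if i % 4 = 0 then 4 else if i % 4 = 2 then 5 else 1
  else if i % 4 = 1 then 3 else if i % 4 = 3 then 2 else 1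

lemma coverColoring_pos_le (a : Fin 3) (i : ℤ) :
    1 ≤ coverColoring a i ∧ coverColoring a i ≤ 5 := by
  unfold coverColoring
  split_ifs <;> omega

lemma coverColoring_eq_of_emod {i j : ℤ} (a : Fin 3) (h : i % 4 = j % 4) :
    coverColoring a i = coverColoring a j := by
  simp only [coverColoring, h]

lemma eq_of_coverColoring_eq (a b : Fin 3) (i j : ℤ) (h : coverColoring a i = coverColoring b j)
    (hd : coverDist a i b j ≤ coverColoring a i) : a = b ∧ i = j := by
  unfold coverColoring coverDist at *
  fin_cases a <;> fin_cases b <;> simp at h hd ⊢ <;> split_ifs at * <;> omega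

lemma exists_packing_five {r : ℕ} (hr : r ≠ 0) (he : Even r) :
    ∃ π, IsPackingColoring (Hgraph r) 5 π := by
  refine ⟨_, isPackingColoring_of_cover hr coverColoring coverColoring_pos_le ?_ ?_⟩
  · intro a i j h
    have : (4 : ℤ) ∣ j - i := by
      obtain ⟨s, rfl⟩ := he
      exact dvd_trans ⟨s, by push_cast; ring⟩ h
    exact coverColoring_eq_of_emod a (by omega)
  · intro a b i j h hd
    obtain ⟨rfl, rfl⟩ := eq_of_coverColoring_eq a b i j h hd
    simp

/-- The modification of `coverColoring` in columns `0, 1, 2` used when `r` is odd. -/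
def oddColoring (a : Fin 3) (n : ℤ) : ℕ :=
  if n = 0 then if a = 0 then 6 else if a = 1 then 1 else 2
  else if n = 1 then if a = 1 then 4 else 1
  else if n = 2 then if a = 0 then 2 else if a = 1 then 5 else 7
  else coverColoring a n

lemma oddColoring_pos_le (a : Fin 3) (n : ℤ) : 1 ≤ oddColoring a n ∧ oddColoring a n ≤ 7 := by
  have := coverColoring_pos_le a n
  unfold oddColoring
  split_ifs <;> omega

lemma oddColoring_of_three_le (a : Fin 3) {n : ℤ} (hn : 3 ≤ n) :
    oddColoring a n = coverColoring a n := by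
  simp [oddColoring, show n ≠ 0 by omega, show n ≠ 1 by omega, show n ≠ 2 by omega]

lemma natAbs_le_coverDist (a b : Fin 3) (i j : ℤ) : (i - j).natAbs ≤ coverDist a i b j := by
  unfold coverDist
  split_ifs <;> omega

lemma coverDist_comm (a b : Fin 3) (i j : ℤ) : coverDist a i b j = coverDist b j a i := by
  unfold coverDist
  split_ifs <;> omega

lemma coverColoring_lt_coverDist_of_four_le {a b : Fin 3} {i j : ℤ}
    (h : coverColoring a i ≠ 1 → a = 1 → b = 1) (hij : 4 ≤ (i - j).natAbs) :
    coverColoring a i < coverDist a i b j := by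
  unfold coverColoring coverDist at *
  split_ifs at * <;> simp_all <;> omega

lemma eq_one_of_coverColoring_eq {a b : Fin 3} {i j : ℤ}
    (h : coverColoring a i = coverColoring b j) (h1 : coverColoring a i ≠ 1) (ha : a = 1) :
    b = 1 := by
  subst ha
  by_contra hb
  simp only [coverColoring, hb, one_ne_zero, if_true, if_false] at h h1
  split_ifs at * <;> omega

lemma oddColoring_lt_coverDist_right {a b : Fin 3} {m j : ℤ} (hm : 0 ≤ m) (hm' : m < 3)
    (hj : 3 ≤ j) (h : oddColoring a m = coverColoring b j) :
    oddColoring a m < coverDist a m b j := by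
  unfold coverColoring coverDist at *
  interval_cases m <;> fin_cases a <;> simp [oddColoring] at h ⊢ <;> split_ifs at * <;>
    simp_all <;> omega

lemma oddColoring_lt_coverDist_left {a b : Fin 3} {m j : ℤ} (hm : 0 ≤ m) (hm' : m < 3)
    (hj : j < 0) (h : oddColoring a m = coverColoring b (j + 2)) :
    oddColoring a m < coverDist a m b j := by
  unfold coverColoring coverDist at *
  interval_cases m <;> fin_cases a <;> simp [oddColoring] at h ⊢ <;> split_ifs at * <;>
    simp_all <;> omega

lemma oddColoring_lt_coverDist {r : ℕ} (ho : r % 2 = 1) {a b : Fin 3} {m n t : ℤ}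
    (hm : 0 ≤ m) (hm' : m < 3) (hn : 3 ≤ n) (hn' : n < 2 * r)
    (ht : t = -1 ∨ t = 0 ∨ t = 1) (h : oddColoring a m = coverColoring b n) :
    oddColoring a m < coverDist a m b (n + 2 * (r * t)) := by
  rcases ht with rfl | rfl | rfl
  · refine oddColoring_lt_coverDist_left hm hm' (by omega)
      (h.trans (coverColoring_eq_of_emod b ?_))
    omega
  · simpa using oddColoring_lt_coverDist_right hm hm' hn h
  · have := natAbs_le_coverDist a b m (n + 2 * (r * 1))
    have := coverColoring_pos_le b n
    omega

lemma eq_of_oddColoring_eq_of_lt {a b : Fin 3} {m n : ℤ} (hm : 0 ≤ m) (hm' : m < 3)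
    (hn : 0 ≤ n) (hn' : n < 3) (h : oddColoring a m = oddColoring b n) :
    (a = b ∧ m = n) ∨ (m - n).natAbs ≤ 2 ∧ oddColoring a m < coverDist a m b n ∧
      oddColoring a m ≤ 2 := by
  interval_cases m <;> interval_cases n <;> revert a b <;> decide

lemma eq_of_oddColoring_eq {r : ℕ} (hr : 3 ≤ r) (ho : r % 2 = 1) (a b : Fin 3) (m n t : ℤ)
    (hm : 0 ≤ m) (hm' : m < 2 * r) (hn : 0 ≤ n) (hn' : n < 2 * r)
    (ht : t = -1 ∨ t = 0 ∨ t = 1)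
    (h : oddColoring a m = oddColoring b n)
    (hd : coverDist a m b (n + 2 * (r * t)) ≤ oddColoring a m) : a = b ∧ m = n := by
  obtain hm3 | hm3 := le_or_gt 3 m <;> obtain hn3 | hn3 := le_or_gt 3 n
  · rw [oddColoring_of_three_le a hm3] at h hd
    rw [oddColoring_of_three_le b hn3] at h
    obtain rfl | ht := eq_or_ne t 0
    · exact eq_of_coverColoring_eq a b m n h (by simpa using hd)
    · refine absurd (coverColoring_lt_coverDist_of_four_le
        (eq_one_of_coverColoring_eq h) ?_) hd.not_gt
      rcases ‹t = -1 ∨ _› with rfl | rfl | rfl <;> omega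
  · rw [coverDist_comm, ← coverDist_shift _ _ _ _ (r * -t)] at hd
    rw [oddColoring_of_three_le a hm3] at h
    have := oddColoring_lt_coverDist (a := b) (b := a) ho hn hn3 hm3 hm' (t := -t) (by omega) h.symm
    ring_nf at hd this
    rw [oddColoring_of_three_le a (by omega)] at hd
    omega
  · rw [oddColoring_of_three_le b hn3] at h
    exact absurd (oddColoring_lt_coverDist ho hm hm3 hn3 hn' ht h) hd.not_gt
  · obtain h' | ⟨h1, h2, h3⟩ := eq_of_oddColoring_eq_of_lt hm hm3 hn hn3 h
    · exact h'
    · have := natAbs_le_coverDist a b m (n + 2 * (r * t))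
      rcases ht with rfl | rfl | rfl
      · omega
      · simp at hd
        omega
      · omega

lemma eq_of_oddColoring_eq_of_five_lt {a b : Fin 3} {m n : ℤ} (h5 : 5 < oddColoring a m)
    (h : oddColoring a m = oddColoring b n) : a = b ∧ m = n := by
  have key : ∀ (a : Fin 3) (m : ℤ), 5 < oddColoring a m →
      m = 0 ∧ a = 0 ∧ oddColoring a m = 6 ∨ m = 2 ∧ a = 2 ∧ oddColoring a m = 7 := by
    intro a m h5
    have := coverColoring_pos_le a m
    unfold oddColoring at h5 ⊢
    split_ifs at h5 ⊢ <;> omega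
  have h1 := key a m h5
  have h2 := key b n (h ▸ h5)
  omega

lemma exists_packing_seven {r : ℕ} (hr : 3 ≤ r) (ho : r % 2 = 1) :
    ∃ π, IsPackingColoring (Hgraph r) 7 π := by
  refine ⟨_, isPackingColoring_of_cover (by omega) (fun a i => oddColoring a (i % (2 * r)))
    (fun _ _ => oddColoring_pos_le _ _) ?_ ?_⟩
  · intro a i j h
    push_cast at h
    exact congrArg (oddColoring a) (Int.modEq_iff_dvd.2 h)
  · intro a b i j h hd
    have hpos : (0 : ℤ) < 2 * r := by omega
    have hm := Int.emod_nonneg i hpos.ne'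
    have hm' := Int.emod_lt_of_pos i hpos
    have hn := Int.emod_nonneg j hpos.ne'
    have hn' := Int.emod_lt_of_pos j hpos
    have hi := Int.emod_add_mul_ediv i (2 * r)
    have hj := Int.emod_add_mul_ediv j (2 * r)
    set m := i % (2 * r)
    set n := j % (2 * r)
    set t := j / (2 * r) - i / (2 * r) with ht
    suffices a = b ∧ m = n by
      refine ⟨this.1, ⟨t, ?_⟩⟩
      push_cast
      linear_combination -this.2 - hj + hi + 2 * (r : ℤ) * ht
    obtain h5 | h5 := lt_or_ge 5 (oddColoring a m)
    · exact eq_of_oddColoring_eq_of_five_lt h5 h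
    have hd' : coverDist a m b (n + 2 * (r * t)) ≤ oddColoring a m := by
      rw [← coverDist_shift a b m _ (r * (i / (2 * r)))]
      convert hd using 2
      · linear_combination hi
      · linear_combination hj + 2 * (r : ℤ) * ht
    have hle := (natAbs_le_coverDist a b m (n + 2 * (r * t))).trans (hd'.trans h5)
    refine eq_of_oddColoring_eq hr ho a b m n t hm hm' hn hn' ?_ h hd'
    have h1 : t < 2 := by
      by_contra! h2
      have : (r : ℤ) * 2 ≤ r * t := by gcongr
      omega
    have h1 : -2 < t := by
      by_contra! h2
      have : (r : ℤ) * t ≤ r * -2 := by gcongr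
      omega
    omega

/-! ### Upper bounds on distances -/

lemma edist_le_of_row {r : ℕ} (hr : r ≠ 0) {a : Fin 3} (ha : a ≠ 1) (i n : ℕ) :
    (Hgraph r).edist (a, (i : ZMod (2 * r))) (a, ((i + n : ℕ) : ZMod (2 * r))) ≤ n := by
  have : Fact (1 < 2 * r) := ⟨by omega⟩
  induction n with
  | zero => simp
  | succ n ih =>
    refine SimpleGraph.edist_triangle.trans ((add_le_add ih (le_of_eq ?_)).trans_eq
      (Nat.cast_succ n).symm)
    rw [SimpleGraph.edist_eq_one_iff_adj, Hgraph, SimpleGraph.fromRel_adj]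
    refine ⟨by simp [← add_assoc], Or.inl ?_⟩
    obtain rfl | rfl : a = 0 ∨ a = 2 := by omega
    · exact Or.inl ⟨_, rfl, by simp [add_assoc]⟩
    · exact Or.inr (Or.inl ⟨_, rfl, by simp [add_assoc]⟩)

lemma edist_le_of_col {r : ℕ} (a b : Fin 3) (z : ZMod (2 * r)) :
    (Hgraph r).edist (a, z) (b, z) ≤ (((a : ℤ) - (b : ℤ)).natAbs : ℕ) := by
  have h01 : (Hgraph r).edist (0, z) (1, z) = 1 := by
    simp [SimpleGraph.edist_eq_one_iff_adj, Hgraph]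
  have h12 : (Hgraph r).edist (1, z) (2, z) = 1 := by
    simp [SimpleGraph.edist_eq_one_iff_adj, Hgraph]
  have h02 : (Hgraph r).edist (0, z) (2, z) ≤ 2 :=
    SimpleGraph.edist_triangle.trans (by rw [h01, h12]; norm_num)
  fin_cases a <;> fin_cases b <;>
    simp [h01.le, h12.le, h02, SimpleGraph.edist_comm.trans_le h01.le,
      SimpleGraph.edist_comm.trans_le h12.le, SimpleGraph.edist_comm.trans_le h02]

lemma edist_le_of_div_two_eq {r : ℕ} (hr : r ≠ 0) {i j : ℕ} (h : i < j) (hij : i / 2 = j / 2) :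
    (Hgraph r).edist ((1 : Fin 3), (i : ZMod (2 * r))) (1, (j : ZMod (2 * r))) = 1 := by
  have : Fact (1 < 2 * r) := ⟨by omega⟩
  obtain ⟨k, rfl⟩ : ∃ k, i = 2 * k := ⟨i / 2, by omega⟩
  obtain rfl : j = 2 * k + 1 := by omega
  have hk : ((2 * (k % r) : ℕ) : ZMod (2 * r)) = (2 * k : ℕ) := by
    rw [ZMod.natCast_eq_natCast_iff]
    exact (Nat.mod_modEq k r).mul_left' 2
  rw [SimpleGraph.edist_eq_one_iff_adj, Hgraph, SimpleGraph.fromRel_adj]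
  refine ⟨by simp, Or.inl (Or.inr (Or.inr (Or.inr (Or.inr
    ⟨k % r, Nat.mod_lt _ (by omega), by rw [hk], ?_⟩))))⟩
  rw [Nat.cast_succ, Nat.cast_succ, hk]

lemma edist_le_coverDist {r : ℕ} (hr : r ≠ 0) (a b : Fin 3) {i j : ℕ} (hij : i ≤ j) :
    (Hgraph r).edist (a, (i : ZMod (2 * r))) (b, (j : ZMod (2 * r))) ≤ coverDist a i b j := by
  obtain ⟨n, rfl⟩ := Nat.exists_eq_add_of_le hij
  have hn : ((i : ℤ) - ((i + n : ℕ) : ℤ)).natAbs = n := by omega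
  have row {a : Fin 3} (ha : a ≠ 1) := edist_le_of_row hr ha i n
  unfold coverDist
  split_ifs with h1 h2 h3
  · obtain ⟨rfl, rfl⟩ := h1
    obtain rfl : n = 0 := by omega
    simp
  · obtain ⟨rfl, rfl⟩ := h1
    exact (edist_le_of_div_two_eq hr (by omega) (by omega)).le
  · obtain ⟨rfl, rfl⟩ := h1
    rw [hn]
    have h10 := edist_le_of_col (r := r) 1 0 i
    have h01 := edist_le_of_col (r := r) 0 1 (i + n : ℕ)
    simp only [Fin.isValue, Fin.val_zero, Fin.val_one, Nat.cast_zero, Nat.cast_one, sub_zero,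
      zero_sub, Int.natAbs_neg, Int.natAbs_one] at h10 h01
    refine (SimpleGraph.edist_triangle.trans (add_le_add h10
      (SimpleGraph.edist_triangle.trans (add_le_add (row (by decide)) h01)))).trans ?_
    norm_cast
    omega
  · rw [hn]
    obtain ha | ha := eq_or_ne a 1
    · refine (SimpleGraph.edist_triangle.trans (add_le_add (edist_le_of_col a b _)
        (row (by tauto)))).trans ?_
      norm_cast
      omega
    · refine (SimpleGraph.edist_triangle.trans (add_le_add (row ha)
        (edist_le_of_col a b _))).trans ?_
      norm_cast

lemma lt_coverDist_of_isPackingColoring {r k : ℕ} {π : Fin 3 × ZMod (2 * r) → ℕ} (hr : r ≠ 0)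
    (hπ : IsPackingColoring (Hgraph r) k π) {a b : Fin 3} {i j : ℕ} (hij : i ≤ j)
    (hne : (a, i) ≠ (b, j)) (hlt : j - i ≤ k → j - i < 2 * r)
    (h : π (a, (i : ZMod (2 * r))) = π (b, (j : ZMod (2 * r)))) :
    π (a, (i : ZMod (2 * r))) < coverDist a i b j := by
  by_contra! hle
  have hk := (hπ.1 (a, (i : ZMod (2 * r)))).2
  have hji := natAbs_le_coverDist a b i j
  have hed := edist_le_coverDist hr a b hij
  obtain ⟨p, hp⟩ := SimpleGraph.exists_walk_of_edist_ne_top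
    (ne_top_of_le_ne_top (ENat.natCast_ne_top _) hed)
  have hp' : p.length ≤ coverDist a i b j := by exact_mod_cast hp.trans_le hed
  refine absurd (hπ.2 _ _ ?_ h p) (by omega)
  intro heq
  obtain ⟨rfl, h2⟩ := Prod.mk.inj heq
  rw [ZMod.natCast_eq_natCast_iff, Nat.modEq_iff_dvd' hij] at h2
  have := Nat.eq_zero_of_dvd_of_lt h2 (hlt (by omega))
  exact hne (by rw [show i = j by omega])

/-! ### Exhaustive search

The vertices of the cover in the columns `0, 1, 2, …` are listed column by column. -/

/-- The distance between the vertices number `i` and `n`. -/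
def listDist (i n : ℕ) : ℕ := coverDist (Fin.ofNat 3 i) (i / 3 : ℕ) (Fin.ofNat 3 n) (n / 3 : ℕ)

/-- Whether vertex number `n` may receive colour `c`, given the colours `l` of the vertices
number `i - 1, …, 0`. -/
def compatible (n c : ℕ) : ℕ → List ℕ → Bool
  | i + 1, x :: l => (x != c || decide (c < listDist i n)) && compatible n c i l
  | _, _ => true

/-- Whether all extensions of the partial packing `k`-colouring `l` of the first `n` vertices
to `m` further vertices satisfy `P`. -/
def searchAll (k : ℕ) (P : List ℕ → Bool) : ℕ → ℕ → List ℕ → Bool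
  | 0, _, l => P l
  | m + 1, n, l => (List.range' 1 k).all fun c =>
      !compatible n c n l || searchAll k P m (n + 1) (c :: l)

/-- The values `f (n - 1), …, f 0`. -/
def revPrefix (f : ℕ → ℕ) : ℕ → List ℕ
  | 0 => []
  | n + 1 => f n :: revPrefix f n

lemma compatible_revPrefix {f : ℕ → ℕ} {n c : ℕ} :
    ∀ i, (∀ j < i, f j = c → c < listDist j n) → compatible n c i (revPrefix f i) = true
  | 0, _ => rfl
  | i + 1, h => by
    have := compatible_revPrefix i fun j hj => h j (by omega)
    have := h i (by omega)
    simp_all [compatible, revPrefix]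
    tauto

lemma of_searchAll {f : ℕ → ℕ} {k N : ℕ} {P : List ℕ → Bool}
    (hk : ∀ n < N, 1 ≤ f n ∧ f n ≤ k)
    (hf : ∀ n < N, ∀ i < n, f i = f n → f n < listDist i n) :
    ∀ m n, n + m = N → searchAll k P m n (revPrefix f n) = true → P (revPrefix f N) = true
  | 0, n, hn, h => by
    obtain rfl : n = N := hn
    exact h
  | m + 1, n, hn, h => by
    simp only [searchAll, List.all_eq_true, List.mem_range'_1] at h
    have := h (f n) (by have := hk n (by omega); omega)
    rw [compatible_revPrefix n fun i hi hc => hf n (by omega) i hi hc] at this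
    exact of_searchAll hk hf m (n + 1) (by omega) this

lemma searchAll_four : searchAll 4 (fun _ => false) 12 0 [] = true := by
  decide +kernel

/-- Among the colours of the vertices in the second and the third pair of columns, exactly one pair
of columns has the colour `4` in its middle row. -/
def alternates : List ℕ → Bool
  | [_, _, _, _, _, _, _, y', _, _, y, _, _, x', _, _, x, _, _, _, _, _, _, _] =>
    (x == 4 || x' == 4) != (y == 4 || y' == 4)
  | _ => false

lemma searchAll_five : searchAll 5 alternates 24 0 [] = true := by
  decide +kernel

/-! ### Lower bounds on the packing chromatic number -/

lemma of_searchAll_of_isPackingColoring {r k M : ℕ} {π : Fin 3 × ZMod (2 * r) → ℕ} (hr : r ≠ 0)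
    (hπ : IsPackingColoring (Hgraph r) k π) (hM : M ≤ 2 * r ∨ k < 2 * r) {P : List ℕ → Bool}
    (h : searchAll k P (3 * M) 0 [] = true) (s : ℕ) :
    P (revPrefix (fun n => π (Fin.ofNat 3 n, ((2 * s + n / 3 : ℕ) : ZMod (2 * r)))) (3 * M)) =
      true := by
  refine of_searchAll (fun n _ => hπ.1 _) (fun n hn i hi heq => ?_) (3 * M) 0 (by simp) h
  have hlt := lt_coverDist_of_isPackingColoring hr hπ (i := 2 * s + i / 3) (j := 2 * s + n / 3)
    (by omega) ?_ (by omega) heq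
  · rw [← heq, listDist, ← coverDist_shift _ _ _ _ s]
    convert hlt using 2 <;> push_cast <;> ring
  · intro h'
    obtain ⟨h1, h2⟩ := Prod.mk.inj h'
    have h1 := congrArg Fin.val h1
    simp only [Fin.ofNat] at h1
    omega

lemma not_isPackingColoring_four {r : ℕ} (hr : 2 ≤ r) (π : Fin 3 × ZMod (2 * r) → ℕ) :
    ¬ IsPackingColoring (Hgraph r) 4 π := fun hπ =>
  absurd (of_searchAll_of_isPackingColoring (M := 4) (by omega) hπ (by omega) searchAll_four 0)
    (by simp)

lemma not_isPackingColoring_five {r : ℕ} (hr : 3 ≤ r) (ho : r % 2 = 1)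
    (π : Fin 3 × ZMod (2 * r) → ℕ) : ¬ IsPackingColoring (Hgraph r) 5 π := by
  intro hπ
  let Q (s : ℕ) : Bool := π (1, ((2 * s : ℕ) : ZMod (2 * r))) == 4 ||
    π (1, ((2 * s + 1 : ℕ) : ZMod (2 * r))) == 4
  have step (s : ℕ) : Q (s + 2) = !Q (s + 1) := by
    have h := of_searchAll_of_isPackingColoring (M := 8) (by omega) hπ (by omega) searchAll_five s
    change (Q (s + 1) != Q (s + 2)) = true at h
    revert h
    cases Q (s + 1) <;> cases Q (s + 2) <;> simp
  have iter (t : ℕ) : Q (2 * t + 1) = Q 1 := by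
    induction t with
    | zero => rfl
    | succ t ih => rw [← ih, mul_add, mul_one, step, step, Bool.not_not]
  have hper : Q (r + 1) = Q 1 := by
    have h0 : (2 : ZMod (2 * r)) * r = 0 := by exact_mod_cast ZMod.natCast_self (2 * r)
    simp only [Q]
    push_cast
    rw [mul_add, h0, zero_add, mul_one]
    norm_num
  have := step (r - 1)
  have := iter (r / 2)
  rw [show r - 1 + 2 = r + 1 by omega, show r - 1 + 1 = r by omega] at *
  rw [show 2 * (r / 2) + 1 = r by omega] at this
  simp_all

lemma lt_packingChromaticNumber {V : Type*} {G : SimpleGraph V} {k m : ℕ} {π : V → ℕ}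
    (hπ : IsPackingColoring G m π) (h : ∀ π, ¬ IsPackingColoring G k π) :
    k < packingChromaticNumber G := by
  obtain ⟨π', hπ'⟩ : packingChromaticNumber G ∈ {k | ∃ π : V → ℕ, IsPackingColoring G k π} :=
    Nat.sInf_mem ⟨m, π, hπ⟩
  by_contra! hle
  exact h π' ⟨fun v => ⟨(hπ'.1 v).1, (hπ'.1 v).2.trans hle⟩, hπ'.2⟩

end Hgraph

theorem packingChromaticNumber_Hgraph (r : ℕ) (hr : 2 ≤ r) :
    (Even r → packingChromaticNumber (Hgraph r) = 5) ∧
    (Odd r → 6 ≤ packingChromaticNumber (Hgraph r) ∧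
      packingChromaticNumber (Hgraph r) ≤ 7) := by
  refine ⟨fun he => ?_, fun ho => ?_⟩
  · obtain ⟨π, hπ⟩ := Hgraph.exists_packing_five (by omega) he
    exact le_antisymm (Nat.sInf_le ⟨π, hπ⟩)
      (Hgraph.lt_packingChromaticNumber hπ (Hgraph.not_isPackingColoring_four hr))
  · have ho' := Nat.odd_iff.1 ho
    have hr3 : 3 ≤ r := by omega
    obtain ⟨π, hπ⟩ := Hgraph.exists_packing_seven hr3 ho'
    exact ⟨Hgraph.lt_packingChromaticNumber hπ (Hgraph.not_isPackingColoring_five hr3 ho'),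
      Nat.sInf_le ⟨π, hπ⟩⟩
end

section
/- Let ℓ ≥ 3 and r ≥ 3 be integers and let π be a packing 5-colouring of the generalised H-graph H^ℓ(r). For every edge u^i_{2j}u^i_{2j+1} with 1 ≤ i ≤ ℓ and 0 ≤ j ≤ r−1 such that π(u^i_{2j}) ≠ 1 and π(u^i_{2j+1}) ≠ 1, one of u^i_{2j}, u^i_{2j+1} has colour 2, and the three neighbours of that vertex have colours 3, 4 and 5 (in some order). -/
/-- The generalised H-graph `H^ℓ(r)` with `ℓ` levels: vertices `uⁱⱼ = (i, j)` for
`i : Fin (ℓ+2)` and `j : ZMod (2*r)`; the outer cycles are on levels `0` and `ℓ+1`,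
level `i` (`1 ≤ i ≤ ℓ`) carries the matching edges `uⁱ₂ⱼuⁱ₂ⱼ₊₁` (`0 ≤ j ≤ r-1`),
and `uⁱⱼ` is joined to `uⁱ⁺¹ⱼ` for `0 ≤ i ≤ ℓ`. -/
def genHgraph (ℓ r : ℕ) : SimpleGraph (Fin (ℓ + 2) × ZMod (2 * r)) :=
  SimpleGraph.fromRel (fun x y =>
    (∃ j : ZMod (2 * r), x = ((0 : Fin (ℓ + 2)), j) ∧ y = ((0 : Fin (ℓ + 2)), j + 1)) ∨
    (∃ j : ZMod (2 * r), x = (Fin.last (ℓ + 1), j) ∧ y = (Fin.last (ℓ + 1), j + 1)) ∨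
    (∃ i : Fin (ℓ + 2), ∃ j : ℕ, 1 ≤ (i : ℕ) ∧ (i : ℕ) ≤ ℓ ∧ j < r ∧
      x = (i, ((2 * j : ℕ) : ZMod (2 * r))) ∧ y = (i, ((2 * j + 1 : ℕ) : ZMod (2 * r)))) ∨
    (∃ i : Fin (ℓ + 2), ∃ j : ZMod (2 * r), (i : ℕ) ≤ ℓ ∧ x = (i, j) ∧ y = (i + 1, j)))

theorem IsPackingColoring.comap {V W : Type*} {G : SimpleGraph V} {H : SimpleGraph W} {k : ℕ}
    {π : W → ℕ} (hπ : IsPackingColoring H k π) (f : G →g H) (hf : Function.Injective f) :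
    IsPackingColoring G k (π ∘ f) :=
  ⟨fun v => hπ.1 (f v), fun u v huv h p => by
    simpa using hπ.2 (f u) (f v) (hf.ne huv) h (p.map f)⟩

theorem IsPackingColoring.ne_of_adj {V : Type*} {G : SimpleGraph V} {k : ℕ} {π : V → ℕ}
    (hπ : IsPackingColoring G k π) {u v : V} (h : G.Adj u v) : π u ≠ π v := fun he => by
  have h1 := hπ.2 u v h.ne he h.toWalk
  have h2 := (hπ.1 u).1
  simp only [SimpleGraph.Walk.length_cons, SimpleGraph.Walk.length_nil] at h1
  omega

theorem IsPackingColoring.ne_of_common_adj {V : Type*} {G : SimpleGraph V} {k : ℕ} {π : V → ℕ}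
    (hπ : IsPackingColoring G k π) {u v w : V} (hu : G.Adj u v) (hw : G.Adj u w) (hvw : v ≠ w)
    (hv : 2 ≤ π v) : π v ≠ π w := fun he => by
  have h1 := hπ.2 v w hvw he (.cons hu.symm hw.toWalk)
  simp only [SimpleGraph.Walk.length_cons, SimpleGraph.Walk.length_nil] at h1
  omega

/-- If every vertex within `d`-distance `k` of `v` has a neighbour that is `d`-closer to `v`, then
`d` bounds the distance to `v` from above as long as it is at most `k`. -/
theorem exists_walk_length_le {V : Type*} {G : SimpleGraph V} {d : V → V → ℕ} {k : ℕ}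
    (hd : ∀ u v, u ≠ v → d u v ≤ k → ∃ w, G.Adj u w ∧ d w v < d u v) (u v : V)
    (huv : d u v ≤ k) : ∃ p : G.Walk u v, p.length ≤ d u v := by
  induction h : d u v using Nat.strong_induction_on generalizing u with
  | _ n ih =>
    by_cases hne : u = v
    · subst hne
      exact ⟨.nil, Nat.zero_le _⟩
    · obtain ⟨w, hw, hlt⟩ := hd u v hne huv
      obtain ⟨p, hp⟩ := ih (d w v) (h ▸ hlt) w (by omega) rfl
      exact ⟨.cons hw p, by simp only [SimpleGraph.Walk.length_cons]; omega⟩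

/-- Whether the partial colouring `s` can be extended to the vertices of a list by colours in
`{1, …, 5}` such that the newly coloured vertices respect the distance bounds `d`. -/
def extendable {V : Type*} [DecidableEq V] (d : V → V → ℕ) : List (V × ℕ) → List V → Bool
  | _, [] => true
  | s, v :: vs => [1, 2, 3, 4, 5].any fun c =>
      s.all (fun x => if x.1 = v then x.2 == c else !(x.2 == c && (d x.1 v).ble c)) &&
        extendable d ((v, c) :: s) vs

theorem IsPackingColoring.extendable {V : Type*} [DecidableEq V] {G : SimpleGraph V}
    {d : V → V → ℕ} {π : V → ℕ} (hπ : IsPackingColoring G 5 π)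
    (hd : ∀ u v, u ≠ v → d u v ≤ 5 → ∃ w, G.Adj u w ∧ d w v < d u v) (vs : List V)
    (s : List (V × ℕ)) (hs : ∀ x ∈ s, π x.1 = x.2) : extendable d s vs = true := by
  induction vs generalizing s with
  | nil => rfl
  | cons v vs ih =>
    have hv := hπ.1 v
    simp only [_root_.extendable, List.any_eq_true, Bool.and_eq_true, List.all_eq_true]
    refine ⟨π v, ?_, fun x hx => ?_, ih _ ?_⟩
    · simp only [List.mem_cons, List.not_mem_nil, or_false]
      omega
    · have hxs := hs x hx
      split_ifs with hxv
      · simp [← hxs, hxv]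
      · simp only [Bool.not_eq_true', Bool.and_eq_false_imp, beq_iff_eq]
        intro hc
        rw [← Bool.not_eq_true, Nat.ble_eq]
        intro hle
        obtain ⟨p, hp⟩ := exists_walk_length_le hd x.1 v (by omega)
        have := hπ.2 x.1 v hxv (by omega) p
        omega
    · simpa using hs

/-- The part of a generalised H-graph consisting of a ladder (columns `1` and `2`) of `m` rows and
the two adjacent columns, where `B` lists the rows lying on an outer cycle. -/
def ladderPiece (m : ℕ) (B : List ℕ) : SimpleGraph (Fin m × Fin 4) :=
  SimpleGraph.fromRel fun x y =>
    ((x.1 : ℕ) + 1 = y.1 ∧ x.2 = y.2) ∨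
      (x.1 = y.1 ∧ (x.2 : ℕ) + 1 = y.2 ∧ ((x.2 : ℕ) = 1 ∨ (x.1 : ℕ) ∈ B))

instance (m : ℕ) (B : List ℕ) : DecidableRel (ladderPiece m B).Adj := fun x y =>
  inferInstanceAs (Decidable (x ≠ y ∧ (_ ∨ _)))

/-- The distance in `ladderPiece m B`, when that is at most `5`. -/
def ladderPieceDist {m : ℕ} (B : List ℕ) (x y : Fin m × Fin 4) : ℕ :=
  if x.2 = y.2 ∨ (x.2 ∈ [1, 2] ∧ y.2 ∈ [1, 2]) then
    Nat.dist x.1 y.1 + Nat.dist x.2 y.2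
  else
    B.foldr (fun h n => min n (Nat.dist x.1 h + Nat.dist y.1 h + Nat.dist x.2 y.2)) 6

/-- A certificate, verified by exhausting the colourings of the vertices in `vs`, that the claim on
rungs without colour `1` holds for the rung in row `t` of `ladderPiece m B`, where `p` and `q` are
the rows next to `t`. -/
structure LadderCertificate (m : ℕ) (B : List ℕ) (p t q : Fin m)
    (vs : List (Fin m × Fin 4)) : Prop where
  descent : ∀ u v : Fin m × Fin 4, u ≠ v → ladderPieceDist B u v ≤ 5 →
    ∃ w, (ladderPiece m B).Adj u w ∧ ladderPieceDist B w v < ladderPieceDist B u v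
  neither : ∀ a ∈ [3, 4, 5], ∀ b ∈ [3, 4, 5],
    extendable (ladderPieceDist B) [((t, 1), a), ((t, 2), b)] ((t, 2) :: vs) = false
  left : ∀ b ∈ [3, 4, 5], ∀ s ∈ [p, q],
    extendable (ladderPieceDist B) [((t, 1), 2), ((t, 2), b), ((s, 1), 1)] vs = false
  right : ∀ a ∈ [3, 4, 5], ∀ s ∈ [p, q],
    extendable (ladderPieceDist B) [((t, 1), a), ((t, 2), 2), ((s, 2), 1)] vs = false

theorem ladderCertificate_row_one : LadderCertificate 5 [0] 0 1 2
    [(0, 2), (0, 1), (2, 1), (2, 2), (3, 2), (3, 1), (0, 3), (0, 0), (4, 2), (4, 1), (1, 3),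
      (1, 0)] := by
  constructor <;> decide +kernel

theorem ladderCertificate_row_two : LadderCertificate 6 [0] 1 2 3
    [(1, 2), (1, 1), (3, 1), (3, 2), (0, 2), (0, 1), (4, 2), (4, 1), (5, 2), (5, 1), (0, 3),
      (0, 0)] := by
  constructor <;> decide +kernel

theorem ladderCertificate_row_two_of_three : LadderCertificate 5 [0, 4] 1 2 3
    [(1, 2), (1, 1), (3, 1), (3, 2), (0, 2), (0, 1), (4, 2), (4, 1), (0, 3), (0, 0), (4, 3),
      (4, 0)] := by
  constructor <;> decide +kernel

theorem ladderCertificate_interior : LadderCertificate 7 [] 2 3 4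
    [(2, 2), (2, 1), (4, 1), (4, 2), (1, 2), (1, 1), (5, 2), (5, 1), (0, 2), (0, 1), (6, 2),
      (6, 1)] := by
  constructor <;> decide +kernel

theorem LadderCertificate.colour_two {m : ℕ} {B : List ℕ} {p t q : Fin m}
    {vs : List (Fin m × Fin 4)} (h : LadderCertificate m B p t q vs) {φ : Fin m × Fin 4 → ℕ}
    (hφ : IsPackingColoring (ladderPiece m B) 5 φ) (h1 : φ (t, 1) ≠ 1) (h2 : φ (t, 2) ≠ 1) :
    (φ (t, 1) = 2 ∧ φ (p, 1) ≠ 1 ∧ φ (q, 1) ≠ 1) ∨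
      (φ (t, 2) = 2 ∧ φ (p, 2) ≠ 1 ∧ φ (q, 2) ≠ 1) := by
  have hb1 := hφ.1 (t, 1)
  have hb2 := hφ.1 (t, 2)
  have hne : φ (t, 1) ≠ φ (t, 2) := hφ.ne_of_adj (by simp [ladderPiece])
  have key : ∀ (us : List (Fin m × Fin 4)) (s : List ((Fin m × Fin 4) × ℕ)),
      _root_.extendable (ladderPieceDist B) s us = false → ¬ ∀ x ∈ s, φ x.1 = x.2 :=
    fun us s hs hx => by simpa [hs] using hφ.extendable h.descent us s hx
  have mem : ∀ n, 3 ≤ n → n ≤ 5 → n ∈ [3, 4, 5] := fun n _ _ => by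
    simp only [List.mem_cons, List.not_mem_nil, or_false]
    omega
  by_cases hx : φ (t, 1) = 2
  · refine Or.inl ⟨hx, fun hz => ?_, fun hz => ?_⟩
    · exact key _ _ (h.left (φ (t, 2)) (mem _ (by omega) (by omega)) p (by simp))
        (by simp [hx, hz])
    · exact key _ _ (h.left (φ (t, 2)) (mem _ (by omega) (by omega)) q (by simp))
        (by simp [hx, hz])
  by_cases hy : φ (t, 2) = 2
  · refine Or.inr ⟨hy, fun hz => ?_, fun hz => ?_⟩
    · exact key _ _ (h.right (φ (t, 1)) (mem _ (by omega) (by omega)) p (by simp))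
        (by simp [hy, hz])
    · exact key _ _ (h.right (φ (t, 1)) (mem _ (by omega) (by omega)) q (by simp))
        (by simp [hy, hz])
  exact (key _ _ (h.neither _ (mem (φ (t, 1)) (by omega) (by omega)) _
    (mem (φ (t, 2)) (by omega) (by omega))) (by simp)).elim

theorem genHgraph_adj_of_val_succ {ℓ r : ℕ} {a b : Fin (ℓ + 2)} (h : (a : ℕ) + 1 = b)
    (k : ZMod (2 * r)) : (genHgraph ℓ r).Adj (a, k) (b, k) := by
  have hb : b = a + 1 := by
    apply Fin.ext
    rw [Fin.val_add_one_of_lt (Fin.lt_def.2 (by simp only [Fin.val_last]; omega)), h]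
  have hab : a ≠ b := fun e => by simp [e] at h
  exact ⟨fun e => hab (congrArg Prod.fst e),
    Or.inl (Or.inr (Or.inr (Or.inr ⟨a, k, by omega, rfl, by rw [hb]⟩)))⟩

theorem genHgraph_adj_outer {ℓ r : ℕ} (hr : 1 ≤ r) {a : Fin (ℓ + 2)}
    (ha : a = 0 ∨ a = Fin.last (ℓ + 1)) (k : ZMod (2 * r)) :
    (genHgraph ℓ r).Adj (a, k) (a, k + 1) := by
  have : Fact (1 < 2 * r) := ⟨by omega⟩
  refine ⟨fun e => by simp at e, Or.inl ?_⟩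
  rcases ha with rfl | rfl
  · exact Or.inl ⟨k, rfl, rfl⟩
  · exact Or.inr (Or.inl ⟨k, rfl, rfl⟩)

theorem genHgraph_adj_rung {ℓ r : ℕ} (a : Fin (ℓ + 2)) {j : ℕ} (hj : j < r) :
    (genHgraph ℓ r).Adj (a, ((2 * j : ℕ) : ZMod (2 * r)))
      (a, ((2 * j + 1 : ℕ) : ZMod (2 * r))) := by
  by_cases ha : a = 0 ∨ a = Fin.last (ℓ + 1)
  · simpa using genHgraph_adj_outer (by omega) ha ((2 * j : ℕ) : ZMod (2 * r))
  · have : Fact (1 < 2 * r) := ⟨by omega⟩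
    rw [not_or, Fin.ext_iff, Fin.ext_iff, Fin.val_zero, Fin.val_last] at ha
    exact ⟨fun e => by simp at e,
      Or.inl (Or.inr (Or.inr (Or.inl ⟨a, j, by omega, by omega, hj, rfl, rfl⟩)))⟩

theorem genHgraph_adj_cases {ℓ r : ℕ} {i : Fin (ℓ + 2)} (hi1 : 1 ≤ (i : ℕ)) (hi2 : (i : ℕ) ≤ ℓ)
    {j : ℕ} (hj : j < r) {k : ZMod (2 * r)} {w : Fin (ℓ + 2) × ZMod (2 * r)}
    (hk : k = ((2 * j : ℕ) : ZMod (2 * r)) ∨ k = ((2 * j + 1 : ℕ) : ZMod (2 * r)))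
    (h : (genHgraph ℓ r).Adj (i, k) w) :
    (w.2 = k ∧ ((i : ℕ) + 1 = w.1 ∨ (w.1 : ℕ) + 1 = i)) ∨
      (w.1 = i ∧ (w.2 = ((2 * j : ℕ) : ZMod (2 * r)) ∨
        w.2 = ((2 * j + 1 : ℕ) : ZMod (2 * r))) ∧ w.2 ≠ k) := by
  have cast_inj : ∀ a b : ℕ, a < 2 * r → b < 2 * r → ((a : ZMod (2 * r)) = b) → a = b := by
    intro a b ha hb hab
    rwa [ZMod.natCast_eq_natCast_iff', Nat.mod_eq_of_lt ha, Nat.mod_eq_of_lt hb] at hab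
  have succ_val : ∀ a : Fin (ℓ + 2), (a : ℕ) ≤ ℓ → ((a + 1 : Fin (ℓ + 2)) : ℕ) = a + 1 :=
    fun a ha => Fin.val_add_one_of_lt (Fin.lt_def.2 (by simp only [Fin.val_last]; omega))
  obtain ⟨w1, w2⟩ := w
  obtain ⟨hne, h⟩ := h
  simp only [Prod.mk.injEq, ne_eq, not_and] at hne h ⊢
  rcases h with (⟨_, ⟨rfl, -⟩, -⟩ | ⟨_, ⟨rfl, -⟩, -⟩ | ⟨a, n, -, -, hn, ⟨rfl, rfl⟩, rfl, rfl⟩ |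
      ⟨a, _, ha, ⟨rfl, rfl⟩, rfl, rfl⟩) |
    (⟨_, -, rfl, -⟩ | ⟨_, -, rfl, -⟩ | ⟨a, n, -, -, hn, ⟨rfl, rfl⟩, rfl, rfl⟩ |
      ⟨a, _, ha, ⟨rfl, rfl⟩, rfl, rfl⟩)
  · simp at hi1
  · simp at hi2
  · have hnj : n = j := by
      rcases hk with hk | hk <;> have := cast_inj _ _ (by omega) (by omega) hk <;> omega
    subst hnj
    exact Or.inr ⟨rfl, Or.inr rfl, fun e => hne rfl e.symm⟩
  · exact Or.inl ⟨rfl, Or.inl (succ_val _ ha).symm⟩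
  · simp at hi1
  · simp at hi2
  · have hnj : n = j := by
      rcases hk with hk | hk <;> have := cast_inj _ _ (by omega) (by omega) hk <;> omega
    subst hnj
    exact Or.inr ⟨rfl, Or.inl rfl, fun e => hne rfl e.symm⟩
  · exact Or.inl ⟨rfl, Or.inr (succ_val _ ha).symm⟩

/-- The columns of `genHgraph ℓ r` that contain, or are adjacent to, the rungs starting in column
`2 * j`. -/
def pieceColumn (r j : ℕ) (b : Fin 4) : ZMod (2 * r) :=
  ((2 * j : ℕ) : ZMod (2 * r)) - 1 + ((b : ℕ) : ZMod (2 * r))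

theorem pieceColumn_injective {r : ℕ} (hr : 2 ≤ r) (j : ℕ) :
    Function.Injective (pieceColumn r j) := fun a b h => by
  have h := add_left_cancel h
  rw [ZMod.natCast_eq_natCast_iff', Nat.mod_eq_of_lt (by omega), Nat.mod_eq_of_lt (by omega)] at h
  exact Fin.ext h

theorem pieceColumn_one (r j : ℕ) : pieceColumn r j 1 = ((2 * j : ℕ) : ZMod (2 * r)) := by
  simp [pieceColumn]

theorem pieceColumn_two (r j : ℕ) : pieceColumn r j 2 = ((2 * j + 1 : ℕ) : ZMod (2 * r)) := by
  simp only [pieceColumn, Fin.val_two]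
  push_cast
  ring

/-- The embedding of a ladder piece induced by an embedding of its rows. -/
def ladderPieceHom {ℓ r m : ℕ} {B : List ℕ} {j : ℕ} (hj : j < r) (ρ : Fin m → Fin (ℓ + 2))
    (hρ : ∀ a b : Fin m, (a : ℕ) + 1 = b → (ρ a : ℕ) + 1 = ρ b ∨ (ρ b : ℕ) + 1 = ρ a)
    (hB : ∀ a : Fin m, (a : ℕ) ∈ B → ρ a = 0 ∨ ρ a = Fin.last (ℓ + 1)) :
    ladderPiece m B →g genHgraph ℓ r where
  toFun x := (ρ x.1, pieceColumn r j x.2)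
  map_rel' := by
    have key : ∀ x y : Fin m × Fin 4, ((x.1 : ℕ) + 1 = y.1 ∧ x.2 = y.2) ∨
        (x.1 = y.1 ∧ (x.2 : ℕ) + 1 = y.2 ∧ ((x.2 : ℕ) = 1 ∨ (x.1 : ℕ) ∈ B)) →
        (genHgraph ℓ r).Adj (ρ x.1, pieceColumn r j x.2) (ρ y.1, pieceColumn r j y.2) := by
      rintro ⟨a, b⟩ ⟨c, d⟩ (⟨h1, h2⟩ | ⟨h1, h2, h3⟩)
      · obtain rfl : b = d := h2
        rcases hρ a c h1 with h | h
        · exact genHgraph_adj_of_val_succ h _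
        · exact (genHgraph_adj_of_val_succ h _).symm
      · obtain rfl : a = c := h1
        rcases h3 with h3 | h3
        · obtain rfl : b = 1 := Fin.ext h3
          obtain rfl : d = 2 := Fin.ext h2.symm
          rw [pieceColumn_one, pieceColumn_two]
          exact genHgraph_adj_rung _ hj
        · have hd : pieceColumn r j d = pieceColumn r j b + 1 := by
            simp only [pieceColumn, ← show (b : ℕ) + 1 = d from h2]
            push_cast
            ring
          rw [hd]
          exact genHgraph_adj_outer (by omega) (hB a h3) _
    rintro x y ⟨-, h | h⟩
    · exact key x y h
    · exact (key y x h).symm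

/-- A rung of a packing `5`-coloured generalised H-graph without colour `1` has an end of colour `2`
with no neighbour of colour `1`, provided that it lies in a certified ladder piece. -/
theorem LadderCertificate.exists_colour_two {ℓ r m : ℕ} {B : List ℕ} {p t q : Fin m}
    {vs : List (Fin m × Fin 4)} (h : LadderCertificate m B p t q vs)
    (hpt : (p : ℕ) + 1 = t) (htq : (t : ℕ) + 1 = q)
    {π : Fin (ℓ + 2) × ZMod (2 * r) → ℕ} (hπ : IsPackingColoring (genHgraph ℓ r) 5 π)
    (hr : 2 ≤ r) {j : ℕ} (hj : j < r) {ρ : Fin m → Fin (ℓ + 2)} (hρi : Function.Injective ρ)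
    (hρ : ∀ a b : Fin m, (a : ℕ) + 1 = b → (ρ a : ℕ) + 1 = ρ b ∨ (ρ b : ℕ) + 1 = ρ a)
    (hB : ∀ a : Fin m, (a : ℕ) ∈ B → ρ a = 0 ∨ ρ a = Fin.last (ℓ + 1))
    (h1 : π (ρ t, ((2 * j : ℕ) : ZMod (2 * r))) ≠ 1)
    (h2 : π (ρ t, ((2 * j + 1 : ℕ) : ZMod (2 * r))) ≠ 1) :
    ∃ k : ZMod (2 * r), (k = ((2 * j : ℕ) : ZMod (2 * r)) ∨
      k = ((2 * j + 1 : ℕ) : ZMod (2 * r))) ∧ π (ρ t, k) = 2 ∧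
        ∀ w, (genHgraph ℓ r).Adj (ρ t, k) w → π w ≠ 1 := by
  have hinj : Function.Injective (ladderPieceHom (B := B) hj ρ hρ hB) := fun x y hxy =>
    Prod.ext (hρi (congrArg Prod.fst hxy)) (pieceColumn_injective hr j (congrArg Prod.snd hxy))
  rw [← pieceColumn_one] at h1
  rw [← pieceColumn_two] at h2
  have hp := hρ p t hpt
  have hq := hρ t q htq
  have hpq : (ρ p : ℕ) ≠ ρ q := fun e => by
    have := hρi (Fin.ext e)
    omega
  have hi1 : 1 ≤ (ρ t : ℕ) := by omega
  have hi2 : (ρ t : ℕ) ≤ ℓ := by omega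
  have hrow : ∀ a : Fin (ℓ + 2), ((ρ t : ℕ) + 1 = a ∨ (a : ℕ) + 1 = ρ t) → a = ρ p ∨ a = ρ q := by
    intro a ha
    rw [Fin.ext_iff, Fin.ext_iff]
    omega
  have hc := h.colour_two (hπ.comap _ hinj) h1 h2
  simp only [Function.comp_apply] at hc
  rcases hc with ⟨hc, hcp, hcq⟩ | ⟨hc, hcp, hcq⟩
  · refine ⟨_, Or.inl (pieceColumn_one r j), hc, ?_⟩
    rintro ⟨w1, w2⟩ hw
    rcases genHgraph_adj_cases hi1 hi2 hj (Or.inl (pieceColumn_one r j)) hw with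
      ⟨rfl, hw1⟩ | ⟨rfl, hw2, hne⟩
    · rcases hrow _ hw1 with rfl | rfl
      · exact hcp
      · exact hcq
    · rcases hw2 with rfl | rfl
      · exact (hne (pieceColumn_one r j).symm).elim
      · rwa [← pieceColumn_two]
  · refine ⟨_, Or.inr (pieceColumn_two r j), hc, ?_⟩
    rintro ⟨w1, w2⟩ hw
    rcases genHgraph_adj_cases hi1 hi2 hj (Or.inr (pieceColumn_two r j)) hw with
      ⟨rfl, hw1⟩ | ⟨rfl, hw2, hne⟩
    · rcases hrow _ hw1 with rfl | rfl
      · exact hcp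
      · exact hcq
    · rcases hw2 with rfl | rfl
      · rwa [← pieceColumn_one]
      · exact (hne (pieceColumn_two r j).symm).elim

theorem genHgraph_exists_colour_two {ℓ r : ℕ} (hℓ : 3 ≤ ℓ) (hr : 2 ≤ r)
    {π : Fin (ℓ + 2) × ZMod (2 * r) → ℕ} (hπ : IsPackingColoring (genHgraph ℓ r) 5 π)
    {j : ℕ} (hj : j < r) (e : Fin (ℓ + 2) → Fin (ℓ + 2)) (he : e = id ∨ e = Fin.rev)
    (i : Fin (ℓ + 2)) (hi1 : 1 ≤ (i : ℕ)) (hi2 : 2 * (i : ℕ) ≤ ℓ + 1)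
    (h1 : π (e i, ((2 * j : ℕ) : ZMod (2 * r))) ≠ 1)
    (h2 : π (e i, ((2 * j + 1 : ℕ) : ZMod (2 * r))) ≠ 1) :
    ∃ k : ZMod (2 * r), (k = ((2 * j : ℕ) : ZMod (2 * r)) ∨
      k = ((2 * j + 1 : ℕ) : ZMod (2 * r))) ∧ π (e i, k) = 2 ∧
        ∀ w, (genHgraph ℓ r).Adj (e i, k) w → π w ≠ 1 := by
  have he_inj : Function.Injective e := by
    rcases he with rfl | rfl
    · exact Function.injective_id
    · exact Fin.rev_injective
  have main : ∀ {m : ℕ} {B : List ℕ} {p t q : Fin m} {vs : List (Fin m × Fin 4)},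
      LadderCertificate m B p t q vs → (p : ℕ) + 1 = t → (t : ℕ) + 1 = q →
      ∀ n : ℕ, n + t = i → n + m ≤ ℓ + 2 → (∀ a ∈ B, a < m → n + a = 0 ∨ n + a = ℓ + 1) →
      ∃ k : ZMod (2 * r), (k = ((2 * j : ℕ) : ZMod (2 * r)) ∨
        k = ((2 * j + 1 : ℕ) : ZMod (2 * r))) ∧ π (e i, k) = 2 ∧
          ∀ w, (genHgraph ℓ r).Adj (e i, k) w → π w ≠ 1 := by
    intro m B p t q vs hcert hpt htq n hn hm hB
    have hi : i = ⟨n + t, by have := t.isLt; omega⟩ := Fin.ext hn.symm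
    rw [hi] at h1 h2 ⊢
    refine hcert.exists_colour_two hpt htq hπ hr hj (ρ := fun a => e ⟨n + a, by omega⟩)
      (fun a b hab => ?_) (fun a b hab => ?_) (fun a ha => ?_) h1 h2
    · have := congrArg Fin.val (he_inj hab)
      simp only at this
      omega
    · rcases he with rfl | rfl
      · simp only [id_eq]
        omega
      · simp only [Fin.val_rev]
        omega
    · have := hB a ha a.isLt
      rw [Fin.ext_iff, Fin.ext_iff, Fin.val_zero, Fin.val_last]
      rcases he with rfl | rfl
      · simp only [id_eq]
        omega
      · simp only [Fin.val_rev]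
        omega
  obtain hi | hi | hi : (i : ℕ) = 1 ∨ (i : ℕ) = 2 ∨ 3 ≤ (i : ℕ) := by omega
  · exact main ladderCertificate_row_one rfl rfl 0 (by simp [hi]) (by omega) (by simp)
  · obtain rfl | hℓ' : ℓ = 3 ∨ 4 ≤ ℓ := by omega
    · exact main ladderCertificate_row_two_of_three rfl rfl 0 (by simp [hi]) (by omega) (by simp)
    · exact main ladderCertificate_row_two rfl rfl 0 (by simp [hi]) (by omega) (by simp)
  · exact main ladderCertificate_interior rfl rfl (i - 3) (Nat.sub_add_cancel hi) (by omega)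
      (by simp)

theorem genHgraph_colour_two (ℓ r : ℕ) (hℓ : 3 ≤ ℓ) (hr : 3 ≤ r)
    (π : Fin (ℓ + 2) × ZMod (2 * r) → ℕ) (hπ : IsPackingColoring (genHgraph ℓ r) 5 π)
    (i : Fin (ℓ + 2)) (hi1 : 1 ≤ (i : ℕ)) (hi2 : (i : ℕ) ≤ ℓ) (j : ℕ) (hj : j < r)
    (h1 : π (i, ((2 * j : ℕ) : ZMod (2 * r))) ≠ 1)
    (h2 : π (i, ((2 * j + 1 : ℕ) : ZMod (2 * r))) ≠ 1) :
    ∃ c ∈ ({(i, ((2 * j : ℕ) : ZMod (2 * r))), (i, ((2 * j + 1 : ℕ) : ZMod (2 * r)))} :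
        Set (Fin (ℓ + 2) × ZMod (2 * r))),
      π c = 2 ∧ π '' {w | (genHgraph ℓ r).Adj c w} = {3, 4, 5} := by
  have hk : ∃ k : ZMod (2 * r), (k = ((2 * j : ℕ) : ZMod (2 * r)) ∨
      k = ((2 * j + 1 : ℕ) : ZMod (2 * r))) ∧ π (i, k) = 2 ∧
        ∀ w, (genHgraph ℓ r).Adj (i, k) w → π w ≠ 1 := by
    by_cases hi : 2 * (i : ℕ) ≤ ℓ + 1
    · exact genHgraph_exists_colour_two hℓ (by omega) hπ hj id (Or.inl rfl) i hi1 hi h1 h2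
    · have := genHgraph_exists_colour_two hℓ (by omega) hπ hj Fin.rev (Or.inr rfl) i.rev
        (by rw [Fin.val_rev]; omega) (by rw [Fin.val_rev]; omega)
      simp only [Fin.rev_rev] at this
      exact this h1 h2
  obtain ⟨k, hk, hc, hw⟩ := hk
  obtain ⟨k', hk', hadj⟩ : ∃ k', k' ≠ k ∧ (genHgraph ℓ r).Adj (i, k) (i, k') := by
    have hrung := genHgraph_adj_rung i hj
    have hne : ((2 * j : ℕ) : ZMod (2 * r)) ≠ ((2 * j + 1 : ℕ) : ZMod (2 * r)) :=
      fun e => hrung.ne (by rw [e])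
    rcases hk with rfl | rfl
    · exact ⟨_, hne.symm, hrung⟩
    · exact ⟨_, hne, hrung.symm⟩
  have hup : (genHgraph ℓ r).Adj (i, k) (⟨i + 1, by omega⟩, k) :=
    genHgraph_adj_of_val_succ rfl k
  have hdown : (genHgraph ℓ r).Adj (i, k) (⟨i - 1, by omega⟩, k) :=
    (genHgraph_adj_of_val_succ (Nat.sub_add_cancel hi1) k).symm
  have hmem : ∀ w, (genHgraph ℓ r).Adj (i, k) w → 3 ≤ π w ∧ π w ≤ 5 := fun w h => by
    have := hw w h
    have := hπ.1 w
    have := hπ.ne_of_adj h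
    omega
  refine ⟨(i, k), by rcases hk with rfl | rfl <;> simp, hc, Set.Subset.antisymm ?_ ?_⟩
  · rintro _ ⟨w, h, rfl⟩
    have := hmem w h
    simp only [Set.mem_insert_iff, Set.mem_singleton_iff]
    omega
  · have hmu := hmem _ hup
    have hmd := hmem _ hdown
    have hma := hmem _ hadj
    have hud := hπ.ne_of_common_adj hup hdown (fun e => by simp at e; omega) (by omega)
    have hua := hπ.ne_of_common_adj hup hadj (fun e => hk' (congrArg Prod.snd e).symm) (by omega)
    have hda := hπ.ne_of_common_adj hdown hadj (fun e => hk' (congrArg Prod.snd e).symm) (by omega)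
    intro n hn
    simp only [Set.mem_insert_iff, Set.mem_singleton_iff] at hn
    have hor : π (⟨i + 1, by omega⟩, k) = n ∨ π (⟨i - 1, by omega⟩, k) = n ∨ π (i, k') = n := by
      omega
    rcases hor with h | h | h
    · exact ⟨_, hup, h⟩
    · exact ⟨_, hdown, h⟩
    · exact ⟨_, hadj, h⟩
end
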